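/- Let A ⊆ C be a unital inclusion of unital C*-algebras with A' ∩ C = C·1 and E^A of Watatani index-finite type, with C*-basic constructions C_1 and C_2 as above. Let f: Pic(A,C) → Pic(C,C_1), f_1: Pic(C,C_1) → Pic(C_1,C_2) be the homomorphisms induced by upward basic construction, and g: Pic(A,C) → Pic(C_1,C_2) the isomorphism induced by the strong Morita equivalence of A ⊆ C and C_1 ⊆ C_2. Then f ∘ g^{-1} ∘ f_1 = id on Pic(C,C_1). -/

import Mathlib

open scoped MultiplierAlgebra

noncomputable section

structure EquivBimodule (C D Y : Type*)
    [NonUnitalCStarAlgebra C] [PartialOrder C] [StarOrderedRing C]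
    [NonUnitalCStarAlgebra D] [PartialOrder D] [StarOrderedRing D]
    [NormedAddCommGroup Y] [NormedSpace ℂ Y] [CompleteSpace Y] : Type _ where
  lsmul : C → Y → Y
  rsmul : Y → D → Y
  linn : Y → Y → C
  rinn : Y → Y → D
  lsmul_add : ∀ c x y, lsmul c (x + y) = lsmul c x + lsmul c y
  add_lsmul : ∀ c c' x, lsmul (c + c') x = lsmul c x + lsmul c' x
  mul_lsmul : ∀ c c' x, lsmul (c * c') x = lsmul c (lsmul c' x)
  smul_lsmul : ∀ (z : ℂ) c x, lsmul (z • c) x = z • lsmul c x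
  lsmul_smul : ∀ (z : ℂ) c x, lsmul c (z • x) = z • lsmul c x
  add_rsmul : ∀ x y d, rsmul (x + y) d = rsmul x d + rsmul y d
  rsmul_add : ∀ x d d', rsmul x (d + d') = rsmul x d + rsmul x d'
  rsmul_mul : ∀ x d d', rsmul x (d * d') = rsmul (rsmul x d) d'
  rsmul_smul : ∀ (z : ℂ) x d, rsmul (z • x) d = z • rsmul x d
  smul_rsmul : ∀ (z : ℂ) x d, rsmul x (z • d) = z • rsmul x d
  lsmul_rsmul : ∀ c x d, rsmul (lsmul c x) d = lsmul c (rsmul x d)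
  linn_add_left : ∀ x y z, linn (x + y) z = linn x z + linn y z
  linn_smul_left : ∀ (t : ℂ) x y, linn (t • x) y = t • linn x y
  linn_star : ∀ x y, star (linn x y) = linn y x
  linn_lsmul_left : ∀ c x y, linn (lsmul c x) y = c * linn x y
  linn_nonneg : ∀ x, 0 ≤ linn x x
  linn_definite : ∀ x, linn x x = 0 → x = 0
  rinn_add_right : ∀ x y z, rinn x (y + z) = rinn x y + rinn x z
  rinn_smul_right : ∀ (t : ℂ) x y, rinn x (t • y) = t • rinn x y
  rinn_star : ∀ x y, star (rinn x y) = rinn y x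
  rinn_rsmul_right : ∀ x y d, rinn x (rsmul y d) = rinn x y * d
  rinn_nonneg : ∀ x, 0 ≤ rinn x x
  rinn_definite : ∀ x, rinn x x = 0 → x = 0
  imprimitivity : ∀ x y z, lsmul (linn x y) z = rsmul x (rinn y z)
  norm_linn : ∀ x, ‖linn x x‖ = ‖x‖ ^ 2
  norm_rinn : ∀ x, ‖rinn x x‖ = ‖x‖ ^ 2
  full_left : Dense (Submodule.span ℂ {c : C | ∃ x y, c = linn x y} : Set C)
  full_right : Dense (Submodule.span ℂ {d : D | ∃ x y, d = rinn x y} : Set D)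

namespace EquivBimodule

variable {C D Y W : Type*}
    [NonUnitalCStarAlgebra C] [PartialOrder C] [StarOrderedRing C]
    [NonUnitalCStarAlgebra D] [PartialOrder D] [StarOrderedRing D]
    [NormedAddCommGroup Y] [NormedSpace ℂ Y] [CompleteSpace Y]
    [NormedAddCommGroup W] [NormedSpace ℂ W] [CompleteSpace W]

structure Iso (E : EquivBimodule C D Y) (F : EquivBimodule C D W) where
  toEquiv : Y ≃ₗ[ℂ] W
  map_lsmul : ∀ c y, toEquiv (E.lsmul c y) = F.lsmul c (toEquiv y)
  map_rsmul : ∀ y d, toEquiv (E.rsmul y d) = F.rsmul (toEquiv y) d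
  map_linn : ∀ x y, F.linn (toEquiv x) (toEquiv y) = E.linn x y
  map_rinn : ∀ x y, F.rinn (toEquiv x) (toEquiv y) = E.rinn x y

end EquivBimodule

def DenseIncl {A C : Type*} [NonUnitalCStarAlgebra C] (ι : A → C) : Prop :=
  Dense (Submodule.span ℂ {x : C | ∃ (a : A) (c : C), x = ι a * c} : Set C)

structure IsMoritaIncl {A B C D Y : Type*}
    [NonUnitalCStarAlgebra C] [PartialOrder C] [StarOrderedRing C]
    [NonUnitalCStarAlgebra D] [PartialOrder D] [StarOrderedRing D]
    [NormedAddCommGroup Y] [NormedSpace ℂ Y] [CompleteSpace Y]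
    (ιA : A → C) (ιB : B → D)
    (E : EquivBimodule C D Y) (X : Submodule ℂ Y) : Prop where
  closed : IsClosed (X : Set Y)
  lsmul_mem : ∀ (a : A), ∀ x ∈ X, E.lsmul (ιA a) x ∈ X
  rsmul_mem : ∀ (b : B), ∀ x ∈ X, E.rsmul x (ιB b) ∈ X
  linn_mem : ∀ x ∈ X, ∀ y ∈ X, E.linn x y ∈ Set.range ιA
  rinn_mem : ∀ x ∈ X, ∀ y ∈ X, E.rinn x y ∈ Set.range ιB
  span_XX_left :
    closure (Submodule.span ℂ {c : C | ∃ x ∈ X, ∃ y ∈ X, c = E.linn x y} : Set C) = Set.range ιA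
  span_YX_left :
    Dense (Submodule.span ℂ {c : C | ∃ (y : Y), ∃ x ∈ X, c = E.linn y x} : Set C)
  span_XX_right :
    closure (Submodule.span ℂ {d : D | ∃ x ∈ X, ∃ y ∈ X, d = E.rinn x y} : Set D) = Set.range ιB
  span_YX_right :
    Dense (Submodule.span ℂ {d : D | ∃ (y : Y), ∃ x ∈ X, d = E.rinn y x} : Set D)

abbrev IsEquiPair {A C Y : Type*}
    [NonUnitalCStarAlgebra C] [PartialOrder C] [StarOrderedRing C]
    [NormedAddCommGroup Y] [NormedSpace ℂ Y] [CompleteSpace Y]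
    (ι : A → C) (E : EquivBimodule C C Y) (X : Submodule ℂ Y) : Prop :=
  IsMoritaIncl ι ι E X

def PairEquiv {C D Y W : Type*}
    [NonUnitalCStarAlgebra C] [PartialOrder C] [StarOrderedRing C]
    [NonUnitalCStarAlgebra D] [PartialOrder D] [StarOrderedRing D]
    [NormedAddCommGroup Y] [NormedSpace ℂ Y] [CompleteSpace Y]
    [NormedAddCommGroup W] [NormedSpace ℂ W] [CompleteSpace W]
    (E : EquivBimodule C D Y) (X : Submodule ℂ Y)
    (F : EquivBimodule C D W) (Z : Submodule ℂ W) : Prop :=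
  ∃ Φ : E.Iso F, X.map Φ.toEquiv.toLinearMap = Z

def IsTrivialData {C : Type*}
    [NonUnitalCStarAlgebra C] [PartialOrder C] [StarOrderedRing C]
    (T : EquivBimodule C C C) : Prop :=
  T.lsmul = (fun c x => c * x) ∧ T.rsmul = (fun x c => x * c) ∧
    T.linn = (fun x y => x * star y) ∧ T.rinn = (fun x y => star x * y)

/-- The data of the equivalence bimodule `Y_σ` induced by an automorphism with
underlying map `σ` (with inverse `σinv`). -/
def IsAlphaData {C : Type*}
    [NonUnitalCStarAlgebra C] [PartialOrder C] [StarOrderedRing C]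
    (σ σinv : C → C) (T : EquivBimodule C C C) : Prop :=
  T.lsmul = (fun c x => c * x) ∧ T.rsmul = (fun x c => x * σ c) ∧
    T.linn = (fun x y => x * star y) ∧ T.rinn = (fun x y => σinv (star x * y))

/-- The submodule `{ι a | a : A}` of `C`, e.g. the subspace `X_α = A` of `Y_α = C`. -/
def rangeSub {A C : Type*} [NonUnitalCStarAlgebra C]
    (ι : A → C) : Submodule ℂ C :=
  Submodule.span ℂ (Set.range ι)

/-- A realization of the interior tensor product `Y ⊗_D W` of equivalence bimodules. -/
structure IsTensorProd {C D L Y W V : Type*}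
    [NonUnitalCStarAlgebra C] [PartialOrder C] [StarOrderedRing C]
    [NonUnitalCStarAlgebra D] [PartialOrder D] [StarOrderedRing D]
    [NonUnitalCStarAlgebra L] [PartialOrder L] [StarOrderedRing L]
    [NormedAddCommGroup Y] [NormedSpace ℂ Y] [CompleteSpace Y]
    [NormedAddCommGroup W] [NormedSpace ℂ W] [CompleteSpace W]
    [NormedAddCommGroup V] [NormedSpace ℂ V] [CompleteSpace V]
    (E : EquivBimodule C D Y) (G : EquivBimodule D L W)
    (F : EquivBimodule C L V) (s : Y → W → V) : Prop where
  add_left : ∀ y y' w, s (y + y') w = s y w + s y' w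
  smul_left : ∀ (z : ℂ) y w, s (z • y) w = z • s y w
  add_right : ∀ y w w', s y (w + w') = s y w + s y w'
  smul_right : ∀ (z : ℂ) y w, s y (z • w) = z • s y w
  balanced : ∀ y d w, s (E.rsmul y d) w = s y (G.lsmul d w)
  map_lsmul : ∀ c y w, F.lsmul c (s y w) = s (E.lsmul c y) w
  map_rsmul : ∀ y w l, F.rsmul (s y w) l = s y (G.rsmul w l)
  map_linn : ∀ y y' w w',
    F.linn (s y w) (s y' w') = E.linn (E.rsmul y (G.linn w w')) y'
  map_rinn : ∀ y y' w w',
    F.rinn (s y w) (s y' w') = G.rinn w (G.lsmul (E.rinn y y') w')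
  dense : Dense (Submodule.span ℂ {v : V | ∃ y w, v = s y w} : Set V)

/-- A realization of the product of two elements of `Equi(A, C)`:
the tensor product bimodule together with the distinguished subspace `X₁ ⊗ X₂`. -/
structure IsPairTensor {A C Y W V : Type*}
    [NonUnitalCStarAlgebra C] [PartialOrder C] [StarOrderedRing C]
    [NormedAddCommGroup Y] [NormedSpace ℂ Y] [CompleteSpace Y]
    [NormedAddCommGroup W] [NormedSpace ℂ W] [CompleteSpace W]
    [NormedAddCommGroup V] [NormedSpace ℂ V] [CompleteSpace V]
    (ι : A → C)
    (E₁ : EquivBimodule C C Y) (X₁ : Submodule ℂ Y)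
    (E₂ : EquivBimodule C C W) (X₂ : Submodule ℂ W)
    (G : EquivBimodule C C V) (XV : Submodule ℂ V) (s : Y → W → V) : Prop where
  tensor : IsTensorProd E₁ E₂ G s
  sub : (XV : Set V) =
    closure (Submodule.span ℂ {v : V | ∃ x ∈ X₁, ∃ z ∈ X₂, v = s x z} : Set V)

section Multiplier

variable {C : Type*} [NonUnitalCStarAlgebra C]

/-- Conjugation `c ↦ u c u*` by a (unitary) multiplier `u ∈ M(C)`. -/
def mAd (u : 𝓜(ℂ, C)) (c : C) : C := u.fst ((star u).snd c)

/-- `m ∈ M(C)` is (the extension of) a multiplier of the subalgebra `A` (realized by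
`ι : A → C`): it maps `A` into `A` on both sides.  When `AC` is dense in `C`, the
multiplier algebra `M(A)` is exactly the set of such multipliers. -/
def IsMultiplierOf {A : Type*} (ι : A → C) (m : 𝓜(ℂ, C)) : Prop :=
  (∀ a : A, m.fst (ι a) ∈ Set.range ι) ∧ (∀ a : A, m.snd (ι a) ∈ Set.range ι)

/-- `u ∈ K(M(C))`: a unitary multiplier with `u a u*, u* a u ∈ A` for all `a ∈ A`. -/
def mem_KMC {A : Type*} (ι : A → C) (u : 𝓜(ℂ, C)) : Prop :=
  u ∈ unitary 𝓜(ℂ, C) ∧ (∀ a : A, mAd u (ι a) ∈ Set.range ι) ∧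
    (∀ a : A, mAd (star u) (ι a) ∈ Set.range ι)

/-- The subspace `Au = {a u | a ∈ A}` of `C`, for a multiplier `u ∈ M(C)`. -/
def AuSub {A : Type*} (ι : A → C) (u : 𝓜(ℂ, C)) : Submodule ℂ C :=
  Submodule.span ℂ {x : C | ∃ a : A, x = u.snd (ι a)}

end Multiplier

/-- A positive element `h` with `hA` dense in `A`; a C*-algebra is σ-unital iff it
possesses such a (strictly positive) element. -/
def SigmaUnital (A : Type*) [NonUnitalCStarAlgebra A] [PartialOrder A]
    [StarOrderedRing A] : Prop :=
  ∃ h : A, 0 ≤ h ∧ Dense (Set.range fun a : A => h * a)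

/-- A system of matrix units over `C` realizing `Cs` as the stabilization `C ⊗ K`. -/
structure IsStabilization {C Cs : Type*} [NonUnitalCStarAlgebra C]
    [NonUnitalCStarAlgebra Cs] (e : ℕ → ℕ → C → Cs) : Prop where
  map_add : ∀ i j c c', e i j (c + c') = e i j c + e i j c'
  map_smul : ∀ i j (z : ℂ) c, e i j (z • c) = z • e i j c
  map_mul : ∀ i j k l c d, e i j c * e k l d = if j = k then e i l (c * d) else 0
  map_star : ∀ i j c, star (e i j c) = e j i (star c)
  isometry : ∀ i j c, ‖e i j c‖ = ‖c‖
  dense : Dense (Submodule.span ℂ {x : Cs | ∃ i j c, x = e i j c} : Set Cs)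

section Unital

variable {A B C D : Type*} [CStarAlgebra A] [CStarAlgebra B] [CStarAlgebra C] [CStarAlgebra D]
  [PartialOrder C] [StarOrderedRing C] [PartialOrder D] [StarOrderedRing D]

/-- A conditional expectation from `C` onto `A`, for a unital inclusion realized by
`ι : A →⋆ₐ[ℂ] C`. -/
structure CondExpectation [PartialOrder A] [StarOrderedRing A] (ι : A →⋆ₐ[ℂ] C) where
  toFun : C → A
  map_add : ∀ x y, toFun (x + y) = toFun x + toFun y
  map_smul : ∀ (z : ℂ) x, toFun (z • x) = z • toFun x
  map_star : ∀ x, toFun (star x) = star (toFun x)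
  retraction : ∀ a, toFun (ι a) = a
  left_mod : ∀ a c, toFun (ι a * c) = a * toFun c
  right_mod : ∀ c a, toFun (c * ι a) = toFun c * a
  pos : ∀ c, 0 ≤ toFun (star c * c)

/-- A quasi-basis for a conditional expectation, in the sense of Watatani. -/
def IsQuasiBasis [PartialOrder A] [StarOrderedRing A] {ι : A →⋆ₐ[ℂ] C}
    (E : CondExpectation ι) {n : ℕ} (u : Fin n → C) : Prop :=
  ∀ c : C, (∑ i, u i * ι (E.toFun (star (u i) * c)) = c) ∧
    (∑ i, ι (E.toFun (c * u i)) * star (u i) = c)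

/-- A conditional expectation is of Watatani index-finite type if it admits a
quasi-basis. -/
def FiniteIndex [PartialOrder A] [StarOrderedRing A] {ι : A →⋆ₐ[ℂ] C}
    (E : CondExpectation ι) : Prop :=
  ∃ (n : ℕ) (u : Fin n → C), IsQuasiBasis E u

/-- `A' ∩ C = ℂ 1` for the inclusion realized by `ι`. -/
def IrreducibleIncl (ι : A →⋆ₐ[ℂ] C) : Prop :=
  ∀ c : C, (∀ a : A, ι a * c = c * ι a) → ∃ z : ℂ, c = z • (1 : C)

variable [PartialOrder A] [StarOrderedRing A] [PartialOrder B] [StarOrderedRing B]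

/-- A conditional expectation `E^X : Y → X` with respect to `E^A` and `E^B`
(Definition 2.4 of [KT4]). -/
structure IsBimodCondExp {Y : Type*}
    [NormedAddCommGroup Y] [NormedSpace ℂ Y] [CompleteSpace Y]
    (ιA : A →⋆ₐ[ℂ] C) (ιB : B →⋆ₐ[ℂ] D)
    (EA : CondExpectation ιA) (EB : CondExpectation ιB)
    (EY : EquivBimodule C D Y) (X : Submodule ℂ Y) (EX : Y → Y) : Prop where
  map_add : ∀ y y', EX (y + y') = EX y + EX y'
  map_smul : ∀ (z : ℂ) y, EX (z • y) = z • EX y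
  mem : ∀ y, EX y ∈ X
  cond1 : ∀ (c : C), ∀ x ∈ X, EX (EY.lsmul c x) = EY.lsmul (ιA (EA.toFun c)) x
  cond2 : ∀ (a : A) (y : Y), EX (EY.lsmul (ιA a) y) = EY.lsmul (ιA a) (EX y)
  cond3 : ∀ (y : Y), ∀ x ∈ X, ιA (EA.toFun (EY.linn y x)) = EY.linn (EX y) x
  cond4 : ∀ (d : D), ∀ x ∈ X, EX (EY.rsmul x d) = EY.rsmul x (ιB (EB.toFun d))
  cond5 : ∀ (b : B) (y : Y), EX (EY.rsmul y (ιB b)) = EY.rsmul (EX y) (ιB b)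
  cond6 : ∀ (y : Y), ∀ x ∈ X, ιB (EB.toFun (EY.rinn y x)) = EY.rinn (EX y) x

/-- The C*-basic construction `C₁` for a conditional expectation `E : C → A`,
realized by a unital embedding `ιC : C →⋆ₐ[ℂ] C₁` and the Jones projection `e`. -/
structure IsBasicConstruction {A C C₁ : Type*} [CStarAlgebra A] [CStarAlgebra C]
    [CStarAlgebra C₁] [PartialOrder A] [StarOrderedRing A]
    [PartialOrder C] [StarOrderedRing C]
    (ι : A →⋆ₐ[ℂ] C) (E : CondExpectation ι)
    (ιC : C →⋆ₐ[ℂ] C₁) (e : C₁) : Prop where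
  inj : Function.Injective ιC
  idem : e * e = e
  selfadj : star e = e
  comm : ∀ a : A, ιC (ι a) * e = e * ιC (ι a)
  expect : ∀ c : C, e * ιC c * e = ιC (ι (E.toFun c)) * e
  faithful : ∀ c : C, ιC c * e = 0 → c = 0
  span : ∀ x : C₁, x ∈ Submodule.span ℂ {z : C₁ | ∃ c d : C, z = ιC c * e * ιC d}

end Unital

/-- `M` is the `A–B`-equivalence bimodule obtained by restricting the operations of the
`C–D`-equivalence bimodule `EY` to the closed subspace `X` (whose inner products on `X`
take values in the subalgebras realized by `ιA`, `ιB`). -/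
structure IsRestriction {A B C D Y : Type*}
    [NonUnitalCStarAlgebra A] [PartialOrder A] [StarOrderedRing A]
    [NonUnitalCStarAlgebra B] [PartialOrder B] [StarOrderedRing B]
    [NonUnitalCStarAlgebra C] [PartialOrder C] [StarOrderedRing C]
    [NonUnitalCStarAlgebra D] [PartialOrder D] [StarOrderedRing D]
    [NormedAddCommGroup Y] [NormedSpace ℂ Y] [CompleteSpace Y]
    (ιA : A → C) (ιB : B → D)
    (EY : EquivBimodule C D Y) (X : Submodule ℂ Y) [CompleteSpace X]
    (M : EquivBimodule A B X) : Prop where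
  lsmul_coe : ∀ (a : A) (x : X), (M.lsmul a x : Y) = EY.lsmul (ιA a) (x : Y)
  rsmul_coe : ∀ (x : X) (b : B), (M.rsmul x b : Y) = EY.rsmul (x : Y) (ιB b)
  linn_coe : ∀ x y : X, ιA (M.linn x y) = EY.linn (x : Y) (y : Y)
  rinn_coe : ∀ x y : X, ιB (M.rinn x y) = EY.rinn (x : Y) (y : Y)

section Upward

variable {A B C D C₁ D₁ : Type*} [CStarAlgebra A] [CStarAlgebra B] [CStarAlgebra C]
  [CStarAlgebra D] [CStarAlgebra C₁] [CStarAlgebra D₁]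
  [PartialOrder A] [StarOrderedRing A] [PartialOrder B] [StarOrderedRing B]
  [PartialOrder C] [StarOrderedRing C] [PartialOrder D] [StarOrderedRing D]
  [PartialOrder C₁] [StarOrderedRing C₁] [PartialOrder D₁] [StarOrderedRing D₁]

/-- A realization of the upward basic construction `C ⊗_A X ⊗_B D̃` as a
`C₁–D₁`-equivalence bimodule, where `M` is the middle `A–B`-equivalence bimodule
(`X` regarded as an `A–B`-bimodule), together with the canonical trilinear map `t`
(the map `(c, x, d) ↦ c ⊗ x ⊗ d̃`, conjugate-linear in the last variable). -/
structure IsUpwardBasic {Xc T : Type*}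
    [NormedAddCommGroup Xc] [NormedSpace ℂ Xc] [CompleteSpace Xc]
    [NormedAddCommGroup T] [NormedSpace ℂ T] [CompleteSpace T]
    (ιA : A →⋆ₐ[ℂ] C) (ιB : B →⋆ₐ[ℂ] D)
    (EA : CondExpectation ιA) (EB : CondExpectation ιB)
    (M : EquivBimodule A B Xc)
    (ιC : C →⋆ₐ[ℂ] C₁) (eA : C₁) (ιD : D →⋆ₐ[ℂ] D₁) (eB : D₁)
    (F : EquivBimodule C₁ D₁ T) (t : C → Xc → D → T) : Prop where
  add₁ : ∀ c c' x d, t (c + c') x d = t c x d + t c' x d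
  smul₁ : ∀ (z : ℂ) c x d, t (z • c) x d = z • t c x d
  add₂ : ∀ c x x' d, t c (x + x') d = t c x d + t c x' d
  smul₂ : ∀ (z : ℂ) c x d, t c (z • x) d = z • t c x d
  add₃ : ∀ c x d d', t c x (d + d') = t c x d + t c x d'
  smul₃ : ∀ (z : ℂ) c x d, t c x (z • d) = (starRingEnd ℂ z) • t c x d
  balanced₁ : ∀ (a : A) c x d, t (c * ιA a) x d = t c (M.lsmul a x) d
  balanced₂ : ∀ (b : B) c x d, t c (M.rsmul x b) d = t c x (d * ιB (star b))
  map_lsmul : ∀ c' c x d, F.lsmul (ιC c') (t c x d) = t (c' * c) x d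
  map_eA : ∀ c x d, F.lsmul eA (t c x d) = t (ιA (EA.toFun c)) x d
  map_rsmul : ∀ c x d d', F.rsmul (t c x d) (ιD d') = t c x (star d' * d)
  map_eB : ∀ c x d, F.rsmul (t c x d) eB = t c x (ιB (EB.toFun d))
  linn_eq : ∀ c c' x x' d d',
    F.linn (t c x d) (t c' x' d') =
      ιC (c * ιA (M.linn (M.rsmul x (EB.toFun (star d * d'))) x')) * eA * ιC (star c')
  rinn_eq : ∀ c c' x x' d d',
    F.rinn (t c x d) (t c' x' d') =
      ιD d * eB * ιD (ιB (M.rinn x (M.lsmul (EA.toFun (star c * c')) x')) * star d')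
  dense : Dense (Submodule.span ℂ {v : T | ∃ c x d, v = t c x d} : Set T)

end Upward

namespace EquivBimodule

section basic
variable {C D Y : Type*}
    [NonUnitalCStarAlgebra C] [PartialOrder C] [StarOrderedRing C]
    [NonUnitalCStarAlgebra D] [PartialOrder D] [StarOrderedRing D]
    [NormedAddCommGroup Y] [NormedSpace ℂ Y] [CompleteSpace Y]
    (E : EquivBimodule C D Y)

def lsmulL (c : C) : Y →ₗ[ℂ] Y where
  toFun := E.lsmul c
  map_add' := E.lsmul_add c
  map_smul' z x := E.lsmul_smul z c x

def rsmulL (d : D) : Y →ₗ[ℂ] Y where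
  toFun y := E.rsmul y d
  map_add' x y := E.add_rsmul x y d
  map_smul' z x := E.rsmul_smul z x d

def lsmulF (x : Y) : C →ₗ[ℂ] Y where
  toFun c := E.lsmul c x
  map_add' c c' := E.add_lsmul c c' x
  map_smul' z c := E.smul_lsmul z c x

def rsmulF (x : Y) : D →ₗ[ℂ] Y where
  toFun d := E.rsmul x d
  map_add' c c' := E.rsmul_add x c c'
  map_smul' z c := E.smul_rsmul z x c

def linnF (y : Y) : Y →ₗ[ℂ] C where
  toFun x := E.linn x y
  map_add' x x' := E.linn_add_left x x' y
  map_smul' z x := E.linn_smul_left z x y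

def rinnF (y : Y) : Y →ₗ[ℂ] D where
  toFun x := E.rinn y x
  map_add' x x' := E.rinn_add_right y x x'
  map_smul' z x := E.rinn_smul_right z y x

lemma linn_add_right (x y z : Y) : E.linn x (y + z) = E.linn x y + E.linn x z := by
  rw [← E.linn_star, E.linn_add_left, star_add, E.linn_star, E.linn_star]

lemma linn_smul_right (t : ℂ) (x y : Y) : E.linn x (t • y) = star t • E.linn x y := by
  rw [← E.linn_star, E.linn_smul_left, star_smul, E.linn_star]

lemma rinn_add_left (x y z : Y) : E.rinn (x + y) z = E.rinn x z + E.rinn y z := by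
  rw [← E.rinn_star, E.rinn_add_right, star_add, E.rinn_star, E.rinn_star]

lemma rinn_smul_left (t : ℂ) (x y : Y) : E.rinn (t • x) y = star t • E.rinn x y := by
  rw [← E.rinn_star, E.rinn_smul_right, star_smul, E.rinn_star]

lemma linn_lsmul_right (c : C) (x y : Y) : E.linn x (E.lsmul c y) = E.linn x y * star c := by
  rw [← E.linn_star, E.linn_lsmul_left, star_mul, E.linn_star]

lemma rinn_rsmul_left (d : D) (x y : Y) : E.rinn (E.rsmul x d) y = star d * E.rinn x y := by
  rw [← E.rinn_star, E.rinn_rsmul_right, star_mul, E.rinn_star]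

lemma lsmul_sum {I : Type*} (s : Finset I) (c : C) (f : I → Y) :
    E.lsmul c (∑ i ∈ s, f i) = ∑ i ∈ s, E.lsmul c (f i) := map_sum (E.lsmulL c) f s
lemma sum_rsmul {I : Type*} (s : Finset I) (d : D) (f : I → Y) :
    E.rsmul (∑ i ∈ s, f i) d = ∑ i ∈ s, E.rsmul (f i) d := map_sum (E.rsmulL d) f s
lemma sum_lsmul {I : Type*} (s : Finset I) (f : I → C) (y : Y) :
    E.lsmul (∑ i ∈ s, f i) y = ∑ i ∈ s, E.lsmul (f i) y := map_sum (E.lsmulF y) f s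
lemma rsmul_sum {I : Type*} (s : Finset I) (f : I → D) (y : Y) :
    E.rsmul y (∑ i ∈ s, f i) = ∑ i ∈ s, E.rsmul y (f i) := map_sum (E.rsmulF y) f s
lemma sum_linn {I : Type*} (s : Finset I) (f : I → Y) (y : Y) :
    E.linn (∑ i ∈ s, f i) y = ∑ i ∈ s, E.linn (f i) y := map_sum (E.linnF y) f s
lemma rinn_sum {I : Type*} (s : Finset I) (f : I → Y) (y : Y) :
    E.rinn y (∑ i ∈ s, f i) = ∑ i ∈ s, E.rinn y (f i) := map_sum (E.rinnF y) f s
lemma linn_sum {I : Type*} (s : Finset I) (f : I → Y) (y : Y) :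
    E.linn y (∑ i ∈ s, f i) = ∑ i ∈ s, E.linn y (f i) := by
  rw [← E.linn_star, E.sum_linn, star_sum]; simp only [E.linn_star]
lemma sum_rinn {I : Type*} (s : Finset I) (f : I → Y) (y : Y) :
    E.rinn (∑ i ∈ s, f i) y = ∑ i ∈ s, E.rinn (f i) y := by
  rw [← E.rinn_star, E.rinn_sum, star_sum]; simp only [E.rinn_star]

lemma linn_sub_left (x x' y : Y) : E.linn (x - x') y = E.linn x y - E.linn x' y :=
  map_sub (E.linnF y) x x'
lemma rinn_sub_right (x x' y : Y) : E.rinn y (x - x') = E.rinn y x - E.rinn y x' :=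
  map_sub (E.rinnF y) x x'
lemma linn_sub_right (x x' y : Y) : E.linn y (x - x') = E.linn y x - E.linn y x' := by
  rw [← E.linn_star, E.linn_sub_left, star_sub, E.linn_star, E.linn_star]
lemma rinn_sub_left (x x' y : Y) : E.rinn (x - x') y = E.rinn x y - E.rinn x' y := by
  rw [← E.rinn_star, E.rinn_sub_right, star_sub, E.rinn_star, E.rinn_star]

lemma ext_linn {x y : Y} (h : ∀ z, E.linn x z = E.linn y z) : x = y := by
  rw [← sub_eq_zero]
  apply E.linn_definite
  rw [E.linn_sub_left, h, sub_self]

lemma ext_rinn {x y : Y} (h : ∀ z, E.rinn z x = E.rinn z y) : x = y := by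
  rw [← sub_eq_zero]
  apply E.rinn_definite
  rw [E.rinn_sub_right, h, sub_self]

lemma eq_zero_of_lsmul (c : C) (h : ∀ z, E.lsmul c z = 0) : c = 0 := by
  have h1 : ∀ b : C, c * b = 0 := by
    intro b
    have hc : IsClosed {b : C | c * b = 0} := isClosed_eq (by fun_prop) (by fun_prop)
    have hs : (Submodule.span ℂ {c : C | ∃ x y, c = E.linn x y} : Set C) ⊆ {b : C | c * b = 0} := by
      intro b hb
      induction hb using Submodule.span_induction with
      | mem x hx =>
        obtain ⟨x, y, rfl⟩ := hx
        show c * _ = 0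
        rw [← E.linn_lsmul_left, h]
        exact map_zero (E.linnF y)
      | zero => simp
      | add x y _ _ hx hy => simp only [Set.mem_ofPred_eq] at *; rw [mul_add, hx, hy, add_zero]
      | smul z x _ hx => simp only [Set.mem_ofPred_eq] at *; rw [mul_smul_comm, hx, smul_zero]
    have := (E.full_left.mono hs).closure_eq
    rw [hc.closure_eq] at this
    exact (this ▸ Set.mem_univ b : b ∈ {b : C | c * b = 0})
  have := h1 (star c)
  exact CStarRing.mul_star_self_eq_zero_iff c |>.mp this

lemma eq_zero_of_rsmul (c : D) (h : ∀ z, E.rsmul z c = 0) : c = 0 := by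
  have h1 : ∀ b : D, b * c = 0 := by
    intro b
    have hc : IsClosed {b : D | b * c = 0} := isClosed_eq (by fun_prop) (by fun_prop)
    have hs : (Submodule.span ℂ {c : D | ∃ x y, c = E.rinn x y} : Set D) ⊆ {b : D | b * c = 0} := by
      intro b hb
      induction hb using Submodule.span_induction with
      | mem x hx =>
        obtain ⟨x, y, rfl⟩ := hx
        show _ * c = 0
        rw [← E.rinn_rsmul_right, h]
        exact map_zero (E.rinnF x)
      | zero => simp
      | add x y _ _ hx hy => simp only [Set.mem_ofPred_eq] at *; rw [add_mul, hx, hy, add_zero]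
      | smul z x _ hx => simp only [Set.mem_ofPred_eq] at *; rw [smul_mul_assoc, hx, smul_zero]
    have := (E.full_right.mono hs).closure_eq
    rw [hc.closure_eq] at this
    exact (this ▸ Set.mem_univ b : b ∈ {b : D | b * c = 0})
  have := h1 (star c)
  exact CStarRing.star_mul_self_eq_zero_iff c |>.mp this

lemma linn_rsmul_left (x y : Y) (d : D) :
    E.linn (E.rsmul x d) y = E.linn x (E.rsmul y (star d)) := by
  rw [← sub_eq_zero]
  apply E.eq_zero_of_lsmul
  intro z
  have : E.lsmul (E.linn (E.rsmul x d) y) z = E.lsmul (E.linn x (E.rsmul y (star d))) z := by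
    rw [E.imprimitivity, E.imprimitivity, E.rinn_rsmul_left, star_star, E.rsmul_mul]
  exact (map_sub (E.lsmulF z) _ _).trans (sub_eq_zero.mpr this)

lemma rinn_lsmul_left (x y : Y) (c : C) :
    E.rinn (E.lsmul c x) y = E.rinn x (E.lsmul (star c) y) := by
  rw [← sub_eq_zero]
  apply E.eq_zero_of_rsmul
  intro z
  have : E.rsmul z (E.rinn (E.lsmul c x) y) = E.rsmul z (E.rinn x (E.lsmul (star c) y)) := by
    rw [← E.imprimitivity, ← E.imprimitivity, E.linn_lsmul_right, E.mul_lsmul]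
  exact (map_sub (E.rsmulF z) _ _).trans (sub_eq_zero.mpr this)

lemma linn_rsmul_right (x y : Y) (d : D) :
    E.linn x (E.rsmul y d) = E.linn (E.rsmul x (star d)) y := by
  rw [E.linn_rsmul_left, star_star]

lemma rinn_lsmul_right (x y : Y) (c : C) :
    E.rinn x (E.lsmul c y) = E.rinn (E.lsmul (star c) x) y := by
  rw [E.rinn_lsmul_left, star_star]

lemma norm_lsmul_le (c : C) (y : Y) : ‖E.lsmul c y‖ ≤ ‖c‖ * ‖y‖ := by
  apply le_of_sq_le_sq _ (by positivity)
  rw [← E.norm_linn, E.linn_lsmul_left, E.linn_lsmul_right]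
  calc ‖c * (E.linn y y * star c)‖ ≤ ‖c‖ * (‖E.linn y y‖ * ‖star c‖) :=
        (norm_mul_le _ _).trans (by gcongr; exact norm_mul_le _ _)
    _ = _ := by rw [E.norm_linn, norm_star]; ring

lemma norm_rsmul_le (c : D) (y : Y) : ‖E.rsmul y c‖ ≤ ‖c‖ * ‖y‖ := by
  apply le_of_sq_le_sq _ (by positivity)
  rw [← E.norm_rinn, E.rinn_rsmul_right, E.rinn_rsmul_left]
  calc ‖star c * E.rinn y y * c‖ ≤ (‖star c‖ * ‖E.rinn y y‖) * ‖c‖ :=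
        (norm_mul_le _ _).trans (by gcongr; exact norm_mul_le _ _)
    _ = _ := by rw [E.norm_rinn, norm_star]; ring

lemma continuous_lsmul (c : C) : Continuous (E.lsmul c) :=
  ((E.lsmulL c).mkContinuous ‖c‖ (E.norm_lsmul_le c)).continuous

lemma continuous_rsmul (c : D) : Continuous (fun y => E.rsmul y c) :=
  ((E.rsmulL c).mkContinuous ‖c‖ (E.norm_rsmul_le c)).continuous

end basic

/-- polarization bound for a norm-controlled sesquilinear form. -/
lemma sesq_bound {C Y : Type*} [NormedAddCommGroup C] [NormedSpace ℂ C]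
    [NormedAddCommGroup Y] [NormedSpace ℂ Y]
    (b : Y → Y → C) (h1 : ∀ x y z, b (x + y) z = b x z + b y z)
    (h2 : ∀ x y z, b x (y + z) = b x y + b x z)
    (h3 : ∀ (t : ℂ) x y, b (t • x) y = t • b x y)
    (h4 : ∀ (t : ℂ) x y, b x (t • y) = star t • b x y)
    (hn : ∀ x, ‖b x x‖ = ‖x‖ ^ 2) (x y : Y) : ‖b x y‖ ≤ 4 * ‖y‖ * ‖x‖ := by
  have key : ∀ x y, ‖b x y‖ ≤ (‖x‖ + ‖y‖) ^ 2 := by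
    intro x y
    have hp : (4 : ℂ) • b x y = b (x + y) (x + y) - b (x + (-1 : ℂ) • y) (x + (-1 : ℂ) • y)
        + Complex.I • b (x + Complex.I • y) (x + Complex.I • y)
        - Complex.I • b (x + (-Complex.I) • y) (x + (-Complex.I) • y) := by
      simp only [h1, h2, h3, h4, Complex.star_def, Complex.conj_I, map_neg, map_one]
      match_scalars <;> ring_nf <;> simp only [Complex.I_sq] <;> norm_num
    have hb : ∀ t : ℂ, ‖t‖ = 1 → ‖b (x + t • y) (x + t • y)‖ ≤ (‖x‖ + ‖y‖) ^ 2 := by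
      intro t ht
      rw [hn]
      gcongr
      refine (norm_add_le _ _).trans ?_
      rw [norm_smul, ht, one_mul]
    have e1 := hb 1 (by simp)
    have e2 := hb (-1) (by simp)
    have e3 := hb Complex.I (by simp)
    have e4 := hb (-Complex.I) (by simp)
    rw [one_smul] at e1
    have : ‖(4 : ℂ) • b x y‖ ≤ 4 * (‖x‖ + ‖y‖) ^ 2 := by
      rw [hp]
      refine (norm_sub_le _ _).trans ?_
      rw [norm_smul, Complex.norm_I, one_mul]
      have := norm_add_le (b (x + y) (x + y) - b (x + (-1 : ℂ) • y) (x + (-1 : ℂ) • y))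
        (Complex.I • b (x + Complex.I • y) (x + Complex.I • y))
      rw [norm_smul, Complex.norm_I, one_mul] at this
      have := norm_sub_le (b (x + y) (x + y)) (b (x + (-1 : ℂ) • y) (x + (-1 : ℂ) • y))
      linarith
    rw [norm_smul] at this
    norm_num at this
    linarith
  by_cases hx : x = 0
  · subst hx
    have := h3 0 0 y
    simp only [zero_smul] at this
    simp [this]
  by_cases hy : y = 0
  · subst hy
    have := h4 0 x 0
    simp only [zero_smul, star_zero] at this
    simp [this]
  have hx' : ‖x‖ ≠ 0 := by simpa using hx
  have hy' : ‖y‖ ≠ 0 := by simpa using hy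
  have := key ((‖x‖⁻¹ : ℂ) • x) ((‖y‖⁻¹ : ℂ) • y)
  rw [h3, h4] at this
  simp only [norm_smul, norm_inv, Complex.norm_real, norm_norm, star_inv₀, Complex.star_def,
    Complex.conj_ofReal] at this
  rw [inv_mul_cancel₀ hx', inv_mul_cancel₀ hy'] at this
  field_simp at this
  linarith

section basic
variable {C D Y : Type*}
    [NonUnitalCStarAlgebra C] [PartialOrder C] [StarOrderedRing C]
    [NonUnitalCStarAlgebra D] [PartialOrder D] [StarOrderedRing D]
    [NormedAddCommGroup Y] [NormedSpace ℂ Y] [CompleteSpace Y]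
    (E : EquivBimodule C D Y)

lemma continuous_linn_left (y : Y) : Continuous fun x => E.linn x y :=
  ((E.linnF y).mkContinuous (4 * ‖y‖) fun x =>
    sesq_bound E.linn E.linn_add_left E.linn_add_right E.linn_smul_left E.linn_smul_right
      E.norm_linn x y).continuous

lemma continuous_rinn_right (y : Y) : Continuous fun x => E.rinn y x :=
  ((E.rinnF y).mkContinuous (4 * ‖y‖) fun x =>
    sesq_bound (fun x y => E.rinn y x) (fun x y z => E.rinn_add_right z x y)
      (fun x y z => E.rinn_add_left y z x) (fun t x y => E.rinn_smul_right t y x)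
      (fun t x y => E.rinn_smul_left t y x)
      E.norm_rinn x y).continuous

lemma continuous_linn_right (y : Y) : Continuous fun x => E.linn y x := by
  simp_rw [← E.linn_star _ y]
  exact (E.continuous_linn_left y).star

lemma continuous_rinn_left (y : Y) : Continuous fun x => E.rinn x y := by
  simp_rw [← E.rinn_star y]
  exact (E.continuous_rinn_right y).star

end basic

end EquivBimodule

/-- extension of an inner-product preserving map given on generators. -/
lemma exists_extension {C D Y C' D' V I : Type*}
    [NonUnitalCStarAlgebra C] [PartialOrder C] [StarOrderedRing C]
    [NonUnitalCStarAlgebra D] [PartialOrder D] [StarOrderedRing D]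
    [NonUnitalCStarAlgebra C'] [PartialOrder C'] [StarOrderedRing C']
    [NonUnitalCStarAlgebra D'] [PartialOrder D'] [StarOrderedRing D']
    [NormedAddCommGroup Y] [NormedSpace ℂ Y] [CompleteSpace Y]
    [NormedAddCommGroup V] [NormedSpace ℂ V] [CompleteSpace V]
    (E : EquivBimodule C D Y) (G : EquivBimodule C' D' V)
    (φ : C →⋆ₙₐ[ℂ] C') (ψ : D →⋆ₙₐ[ℂ] D') (hφ : Function.Injective φ)
    (hψ : Function.Injective ψ)
    (s : I → Y) (k : I → V) (hs : Dense (Submodule.span ℂ (Set.range s) : Set Y))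
    (hl : ∀ i j, G.linn (k i) (k j) = φ (E.linn (s i) (s j)))
    (hr : ∀ i j, G.rinn (k i) (k j) = ψ (E.rinn (s i) (s j))) :
    ∃ K : Y →ₗᵢ[ℂ] V, (∀ i, K (s i) = k i) ∧
      (∀ x y, G.linn (K x) (K y) = φ (E.linn x y)) ∧
      (∀ x y, G.rinn (K x) (K y) = ψ (E.rinn x y)) ∧
      LinearMap.range K.toLinearMap = (Submodule.span ℂ (Set.range k)).topologicalClosure := by
  have nφ := NonUnitalStarAlgHom.norm_map φ hφ
  have nψ := NonUnitalStarAlgHom.norm_map ψ hψ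
  have cφ : Continuous φ := (NonUnitalStarAlgHom.isometry φ hφ).continuous
  have cψ : Continuous ψ := (NonUnitalStarAlgHom.isometry ψ hψ).continuous
  let a : (I →₀ ℂ) →ₗ[ℂ] Y := Finsupp.linearCombination ℂ s
  let b : (I →₀ ℂ) →ₗ[ℂ] V := Finsupp.linearCombination ℂ k
  have hla : ∀ f g, G.linn (b f) (b g) = φ (E.linn (a f) (a g)) := by
    intro f g
    simp only [a, b, Finsupp.linearCombination_apply, Finsupp.sum, E.sum_linn, E.linn_sum,
      G.sum_linn, G.linn_sum, E.linn_smul_left, E.linn_smul_right, G.linn_smul_left,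
      G.linn_smul_right, map_sum, map_smul, hl]
  have hra : ∀ f g, G.rinn (b f) (b g) = ψ (E.rinn (a f) (a g)) := by
    intro f g
    simp only [a, b, Finsupp.linearCombination_apply, Finsupp.sum, E.sum_rinn, E.rinn_sum,
      G.sum_rinn, G.rinn_sum, E.rinn_smul_left, E.rinn_smul_right, G.rinn_smul_left,
      G.rinn_smul_right, map_sum, map_smul, hr]
  have hnorm : ∀ f, ‖b f‖ = ‖a f‖ := by
    intro f
    have := G.norm_linn (b f)
    rw [hla, nφ, E.norm_linn] at this
    exact ((sq_eq_sq₀ (norm_nonneg _) (norm_nonneg _)).mp this).symm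
  have hda : DenseRange a := by
    have : Set.range a = (Submodule.span ℂ (Set.range s) : Set Y) := by
      rw [← Finsupp.range_linearCombination]; rfl
    rw [DenseRange, this]; exact hs
  let K₀ : Y →L[ℂ] V := b.extendOfNorm a
  have hK₀ : ∀ f, K₀ (a f) = b f :=
    LinearMap.extendOfNorm_eq hda ⟨1, fun f => by rw [one_mul, hnorm]⟩
  have hKn : ∀ y, ‖K₀ y‖ = ‖y‖ := by
    intro y
    refine hda.induction_on (p := fun y => ‖K₀ y‖ = ‖y‖) y
      (isClosed_eq (by fun_prop) (by fun_prop)) ?_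
    intro f
    rw [hK₀, hnorm]
  let K : Y →ₗᵢ[ℂ] V := ⟨K₀.toLinearMap, hKn⟩
  have hK : ∀ f, K (a f) = b f := hK₀
  have has : ∀ i, a (Finsupp.single i 1) = s i := by intro i; simp [a]
  have hbk : ∀ i, b (Finsupp.single i 1) = k i := by intro i; simp [b]
  have hKs : ∀ i, K (s i) = k i := by
    intro i
    rw [← has, hK, hbk]
  refine ⟨K, hKs, ?_, ?_, ?_⟩
  · intro x y
    refine hda.induction_on (p := fun x => G.linn (K x) (K y) = φ (E.linn x y)) x
      (isClosed_eq ((G.continuous_linn_left _).comp K.continuous)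
        (cφ.comp (E.continuous_linn_left _))) ?_
    intro f
    refine hda.induction_on (p := fun y => G.linn (K (a f)) (K y) = φ (E.linn (a f) y)) y
      (isClosed_eq ((G.continuous_linn_right _).comp K.continuous)
        (cφ.comp (E.continuous_linn_right _))) ?_
    intro g
    rw [hK, hK, hla]
  · intro x y
    refine hda.induction_on (p := fun x => G.rinn (K x) (K y) = ψ (E.rinn x y)) x
      (isClosed_eq ((G.continuous_rinn_left _).comp K.continuous)
        (cψ.comp (E.continuous_rinn_left _))) ?_
    intro f
    refine hda.induction_on (p := fun y => G.rinn (K (a f)) (K y) = ψ (E.rinn (a f) y)) y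
      (isClosed_eq ((G.continuous_rinn_right _).comp K.continuous)
        (cψ.comp (E.continuous_rinn_right _))) ?_
    intro g
    rw [hK, hK, hra]
  · apply le_antisymm
    · rintro _ ⟨y, rfl⟩
      refine hda.induction_on
        (p := fun y => K y ∈ (Submodule.span ℂ (Set.range k)).topologicalClosure) y
        ((Submodule.isClosed_topologicalClosure _).preimage K.continuous) ?_
      intro f
      rw [hK]
      apply Submodule.le_topologicalClosure
      rw [← Finsupp.range_linearCombination]
      exact ⟨f, rfl⟩
    · apply Submodule.topologicalClosure_minimal
      · rw [Submodule.span_le]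
        rintro _ ⟨i, rfl⟩
        exact ⟨s i, hKs i⟩
      · have := K.isometry.isClosedEmbedding.isClosed_range
        exact this

lemma EquivBimodule.one_lsmul {C D Y : Type*}
    [CStarAlgebra C] [PartialOrder C] [StarOrderedRing C]
    [NonUnitalCStarAlgebra D] [PartialOrder D] [StarOrderedRing D]
    [NormedAddCommGroup Y] [NormedSpace ℂ Y] [CompleteSpace Y]
    (E : EquivBimodule C D Y) (y : Y) : E.lsmul 1 y = y := by
  apply E.ext_linn
  intro z
  rw [E.linn_lsmul_left, one_mul]

lemma EquivBimodule.rsmul_one {C D Y : Type*}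
    [NonUnitalCStarAlgebra C] [PartialOrder C] [StarOrderedRing C]
    [CStarAlgebra D] [PartialOrder D] [StarOrderedRing D]
    [NormedAddCommGroup Y] [NormedSpace ℂ Y] [CompleteSpace Y]
    (E : EquivBimodule C D Y) (y : Y) : E.rsmul y 1 = y := by
  apply E.ext_rinn
  intro z
  rw [E.rinn_rsmul_right, mul_one]

lemma one_mem_of_dense {C : Type*} [CStarAlgebra C] (S : Submodule ℂ C)
    (hd : Dense (S : Set C)) (hS : ∀ a, ∀ s ∈ S, a * s ∈ S) : (1 : C) ∈ S := by
  obtain ⟨s, hs, hsu⟩ := hd.inter_open_nonempty _ (Units.isOpen (R := C)) ⟨1, isUnit_one⟩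
  obtain ⟨v, rfl⟩ := hs
  have := hS (↑v⁻¹) _ hsu
  rwa [Units.inv_mul] at this

section Unital2

variable {A C C₁ Y : Type*} [CStarAlgebra A] [CStarAlgebra C] [CStarAlgebra C₁]
  [PartialOrder A] [StarOrderedRing A] [PartialOrder C] [StarOrderedRing C]
  [PartialOrder C₁] [StarOrderedRing C₁]
  [NormedAddCommGroup Y] [NormedSpace ℂ Y] [CompleteSpace Y]
  {ι : A →⋆ₐ[ℂ] C} {E : CondExpectation ι} {n : ℕ} {u : Fin n → C}
  {EY : EquivBimodule C C Y} {X : Submodule ℂ Y} {EX : Y → Y}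

lemma CondExpectation.map_sum {I : Type*} (E : CondExpectation ι) (s : Finset I) (f : I → C) :
    E.toFun (∑ i ∈ s, f i) = ∑ i ∈ s, E.toFun (f i) :=
  _root_.map_sum (AddMonoidHom.mk' E.toFun E.map_add) f s

lemma CondExpectation.map_one (E : CondExpectation ι) : E.toFun 1 = 1 := by
  have := E.retraction 1
  rwa [_root_.map_one] at this

lemma IsBimodCondExp.map_sum (hEX : IsBimodCondExp ι ι E E EY X EX) {I : Type*}
    (s : Finset I) (f : I → Y) :
    EX (∑ i ∈ s, f i) = ∑ i ∈ s, EX (f i) :=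
  _root_.map_sum (AddMonoidHom.mk' EX hEX.map_add) f s

lemma IsMoritaIncl.span_rsmul (hp : IsEquiPair ⇑ι EY X) (z : Y) :
    z ∈ Submodule.span ℂ {v : Y | ∃ x ∈ X, ∃ c : C, v = EY.rsmul x c} := by
  have h1 : (1 : C) ∈ Submodule.span ℂ {c : C | ∃ (y : Y), ∃ x ∈ X, c = EY.linn y x} := by
    apply one_mem_of_dense _ hp.span_YX_left
    intro a s hs
    induction hs using Submodule.span_induction with
    | mem s hs =>
      obtain ⟨y, x, hx, rfl⟩ := hs
      exact Submodule.subset_span ⟨EY.lsmul a y, x, hx, (EY.linn_lsmul_left _ _ _).symm⟩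
    | zero => simp
    | add x y _ _ hx hy => rw [mul_add]; exact Submodule.add_mem _ hx hy
    | smul z x _ hx => rw [mul_smul_comm]; exact Submodule.smul_mem _ _ hx
  have h2 : ∀ c ∈ Submodule.span ℂ {c : C | ∃ (y : Y), ∃ x ∈ X, c = EY.linn y x},
      EY.lsmul (star c) z ∈ Submodule.span ℂ {v : Y | ∃ x ∈ X, ∃ c : C, v = EY.rsmul x c} := by
    intro c hc
    induction hc using Submodule.span_induction with
    | mem s hs =>
      obtain ⟨y, x, hx, rfl⟩ := hs
      rw [EY.linn_star, EY.imprimitivity]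
      exact Submodule.subset_span ⟨x, hx, _, rfl⟩
    | zero => rw [star_zero]; rw [show EY.lsmul 0 z = 0 from map_zero (EY.lsmulF z)]; simp
    | add x y _ _ hx hy => rw [star_add, EY.add_lsmul]; exact Submodule.add_mem _ hx hy
    | smul z x _ hx => rw [star_smul, EY.smul_lsmul]; exact Submodule.smul_mem _ _ hx
  have := h2 1 h1
  rwa [star_one, EY.one_lsmul] at this

lemma IsMoritaIncl.span_lsmul (hp : IsEquiPair ⇑ι EY X) (z : Y) :
    z ∈ Submodule.span ℂ {v : Y | ∃ x ∈ X, ∃ c : C, v = EY.lsmul c x} := by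
  have h1 : (1 : C) ∈ Submodule.span ℂ {c : C | ∃ (y : Y), ∃ x ∈ X, c = EY.rinn y x} := by
    apply one_mem_of_dense _ hp.span_YX_right
    intro a s hs
    induction hs using Submodule.span_induction with
    | mem s hs =>
      obtain ⟨y, x, hx, rfl⟩ := hs
      exact Submodule.subset_span ⟨EY.rsmul y (star a), x, hx, by
        rw [EY.rinn_rsmul_left, star_star]⟩
    | zero => simp
    | add x y _ _ hx hy => rw [mul_add]; exact Submodule.add_mem _ hx hy
    | smul z x _ hx => rw [mul_smul_comm]; exact Submodule.smul_mem _ _ hx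
  have h2 : ∀ c ∈ Submodule.span ℂ {c : C | ∃ (y : Y), ∃ x ∈ X, c = EY.rinn y x},
      EY.rsmul z c ∈ Submodule.span ℂ {v : Y | ∃ x ∈ X, ∃ c : C, v = EY.lsmul c x} := by
    intro c hc
    induction hc using Submodule.span_induction with
    | mem s hs =>
      obtain ⟨y, x, hx, rfl⟩ := hs
      rw [← EY.imprimitivity]
      exact Submodule.subset_span ⟨x, hx, _, rfl⟩
    | zero => rw [show EY.rsmul z 0 = 0 from map_zero (EY.rsmulF z)]; simp
    | add x y _ _ hx hy => rw [EY.rsmul_add]; exact Submodule.add_mem _ hx hy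
    | smul z x _ hx => rw [EY.smul_rsmul]; exact Submodule.smul_mem _ _ hx
  have := h2 1 h1
  rwa [EY.rsmul_one] at this

lemma reconstruct_right (hu : IsQuasiBasis E u) (hp : IsEquiPair ⇑ι EY X)
    (hEX : IsBimodCondExp ι ι E E EY X EX) (y : Y) :
    ∑ l, EY.rsmul (EX (EY.rsmul y (u l))) (star (u l)) = y := by
  have := IsMoritaIncl.span_rsmul hp y
  induction this using Submodule.span_induction with
  | mem s hs =>
    obtain ⟨x, hx, c, rfl⟩ := hs
    simp_rw [← EY.rsmul_mul, hEX.cond4 _ x hx, ← EY.rsmul_mul]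
    rw [← EY.rsmul_sum, (hu c).2]
  | zero =>
    have h0 : ∀ c, EY.rsmul 0 c = 0 := fun c => map_zero (EY.rsmulL c)
    have h1 : EX 0 = 0 := by have := hEX.map_smul 0 0; simpa using this
    simp [h0, h1]
  | add x y _ _ hx hy =>
    simp_rw [EY.add_rsmul, hEX.map_add, EY.add_rsmul, Finset.sum_add_distrib]; rw [hx, hy]
  | smul z x _ hx =>
    simp_rw [EY.rsmul_smul, hEX.map_smul, EY.rsmul_smul, ← Finset.smul_sum]; rw [hx]

lemma reconstruct_left (hu : IsQuasiBasis E u) (hp : IsEquiPair ⇑ι EY X)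
    (hEX : IsBimodCondExp ι ι E E EY X EX) (y : Y) :
    ∑ l, EY.lsmul (u l) (EX (EY.lsmul (star (u l)) y)) = y := by
  have := IsMoritaIncl.span_lsmul hp y
  induction this using Submodule.span_induction with
  | mem s hs =>
    obtain ⟨x, hx, c, rfl⟩ := hs
    simp_rw [← EY.mul_lsmul, hEX.cond1 _ x hx, ← EY.mul_lsmul]
    rw [← EY.sum_lsmul, (hu c).1]
  | zero =>
    have h0 : ∀ c, EY.lsmul c 0 = 0 := fun c => map_zero (EY.lsmulL c)
    have h1 : EX 0 = 0 := by have := hEX.map_smul 0 0; simpa using this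
    simp [h0, h1]
  | add x y _ _ hx hy =>
    simp_rw [EY.lsmul_add, hEX.map_add, EY.lsmul_add, Finset.sum_add_distrib]; rw [hx, hy]
  | smul z x _ hx =>
    simp_rw [EY.lsmul_smul, hEX.map_smul, EY.lsmul_smul, ← Finset.smul_sum]; rw [hx]

variable {ιC : C →⋆ₐ[ℂ] C₁} {e : C₁}

lemma sum_jones (hu : IsQuasiBasis E u) (hbc : IsBasicConstruction ι E ιC e) :
    ∑ i, ιC (u i) * e * ιC (star (u i)) = 1 := by
  have key : ∀ x ∈ Submodule.span ℂ {z : C₁ | ∃ c d : C, z = ιC c * e * ιC d},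
      (∑ i, ιC (u i) * e * ιC (star (u i))) * x = x := by
    intro x hx
    induction hx using Submodule.span_induction with
    | mem s hs =>
      obtain ⟨c, d, rfl⟩ := hs
      rw [Finset.sum_mul]
      have : ∀ i, ιC (u i) * e * ιC (star (u i)) * (ιC c * e * ιC d) =
          ιC (u i * ι (E.toFun (star (u i) * c))) * (e * ιC d) := by
        intro i
        calc _ = ιC (u i) * (e * ιC (star (u i) * c) * e) * ιC d := by
              rw [map_mul]; simp only [mul_assoc]
          _ = _ := by rw [hbc.expect, map_mul]; simp only [mul_assoc]
      simp_rw [this]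
      rw [← Finset.sum_mul, ← map_sum, (hu c).1, mul_assoc]
    | zero => simp
    | add x y _ _ hx hy => rw [mul_add, hx, hy]
    | smul z x _ hx => rw [mul_smul_comm, hx]
  have := key 1 (hbc.span 1)
  rwa [mul_one] at this

lemma faithful_left (hbc : IsBasicConstruction ι E ιC e) (c : C) (h : e * ιC c = 0) : c = 0 := by
  have h2 := congrArg star h
  rw [star_mul, hbc.selfadj, star_zero, ← map_star] at h2
  have := hbc.faithful _ h2
  simpa using this

end Unital2

section Upward2

variable {A C C₁ Xc T : Type*} [CStarAlgebra A] [CStarAlgebra C] [CStarAlgebra C₁]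
  [PartialOrder A] [StarOrderedRing A] [PartialOrder C] [StarOrderedRing C]
  [PartialOrder C₁] [StarOrderedRing C₁]
  [NormedAddCommGroup Xc] [NormedSpace ℂ Xc] [CompleteSpace Xc]
  [NormedAddCommGroup T] [NormedSpace ℂ T] [CompleteSpace T]
  {ι : A →⋆ₐ[ℂ] C} {E : CondExpectation ι} {M : EquivBimodule A A Xc}
  {ιC : C →⋆ₐ[ℂ] C₁} {e : C₁} {F : EquivBimodule C₁ C₁ T} {t : C → Xc → C → T}

namespace IsUpwardBasic

lemma sum₁ (h : IsUpwardBasic ι ι E E M ιC e ιC e F t) {I : Type*} (s : Finset I)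
    (f : I → C) (x : Xc) (d : C) : t (∑ i ∈ s, f i) x d = ∑ i ∈ s, t (f i) x d :=
  map_sum (AddMonoidHom.mk' (fun c => t c x d) fun a b => h.add₁ a b x d) f s

lemma sum₂ (h : IsUpwardBasic ι ι E E M ιC e ιC e F t) {I : Type*} (s : Finset I)
    (f : I → Xc) (c : C) (d : C) : t c (∑ i ∈ s, f i) d = ∑ i ∈ s, t c (f i) d :=
  map_sum (AddMonoidHom.mk' (fun x => t c x d) fun a b => h.add₂ c a b d) f s

lemma sum₃ (h : IsUpwardBasic ι ι E E M ιC e ιC e F t) {I : Type*} (s : Finset I)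
    (f : I → C) (x : Xc) (c : C) : t c x (∑ i ∈ s, f i) = ∑ i ∈ s, t c x (f i) :=
  map_sum (AddMonoidHom.mk' (fun d => t c x d) fun a b => h.add₃ c x a b) f s

lemma bal₁ (h : IsUpwardBasic ι ι E E M ιC e ιC e F t) (a : A) (x : Xc) (d : C) :
    t (ι a) x d = t 1 (M.lsmul a x) d := by
  rw [← h.balanced₁, one_mul]

lemma bal₂ (h : IsUpwardBasic ι ι E E M ιC e ιC e F t) (a : A) (x : Xc) (c : C) :
    t c x (ι a) = t c (M.rsmul x (star a)) 1 := by
  rw [h.balanced₂, one_mul, star_star]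

end IsUpwardBasic

end Upward2

section JMap

variable {A C C₁ Y T : Type*} [CStarAlgebra A] [CStarAlgebra C] [CStarAlgebra C₁]
  [PartialOrder A] [StarOrderedRing A] [PartialOrder C] [StarOrderedRing C]
  [PartialOrder C₁] [StarOrderedRing C₁]
  [NormedAddCommGroup Y] [NormedSpace ℂ Y] [CompleteSpace Y]
  [NormedAddCommGroup T] [NormedSpace ℂ T] [CompleteSpace T]
  {ι : A →⋆ₐ[ℂ] C} {E : CondExpectation ι} {n : ℕ} {u : Fin n → C}
  {EY : EquivBimodule C C Y} {X : Submodule ℂ Y} {EX : Y → Y} [CompleteSpace X]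
  {M : EquivBimodule A A X}
  {ιC : C →⋆ₐ[ℂ] C₁} {e : C₁} {F : EquivBimodule C₁ C₁ T} {t : C → X → C → T}

/-- the canonical embedding of `Y` in its upward basic construction. -/
def jmap (EY : EquivBimodule C C Y) (u : Fin n → C) (EX : Y → Y) (hm : ∀ y, EX y ∈ X)
    (t : C → X → C → T) (y : Y) : T :=
  ∑ i, ∑ j, t (u i) ⟨EX (EY.lsmul (star (u i)) (EY.rsmul y (u j))), hm _⟩ (u j)

lemma linn_EX_right (hEX : IsBimodCondExp ι ι E E EY X EX) (x y : Y) (hx : x ∈ X) :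
    EY.linn x (EX y) = ι (E.toFun (EY.linn x y)) := by
  rw [← EY.linn_star, ← hEX.cond3 y x hx, ← EY.linn_star y x, E.map_star, map_star]

lemma linn_t_jmap (hu : IsQuasiBasis E u)
    (hbc : IsBasicConstruction ι E ιC e) (hM : IsRestriction ⇑ι ⇑ι EY X M)
    (hEX : IsBimodCondExp ι ι E E EY X EX) (hup : IsUpwardBasic ι ι E E M ιC e ιC e F t)
    (c : C) (x : X) (d : C) (y : Y) :
    F.linn (t c x d) (jmap EY u EX hEX.mem t y) =
      ιC c * e * ιC (EY.linn (EY.rsmul x (star d)) y) := by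
  have h1 : ∀ k, ∑ l, ι (M.linn (M.rsmul x (E.toFun (star d * u l)))
      ⟨EX (EY.lsmul (star (u k)) (EY.rsmul y (u l))), hEX.mem _⟩) =
      ι (E.toFun (EY.linn (EY.rsmul x (star d)) y * u k)) := by
    intro k
    have : ∀ l, ι (M.linn (M.rsmul x (E.toFun (star d * u l)))
      ⟨EX (EY.lsmul (star (u k)) (EY.rsmul y (u l))), hEX.mem _⟩) =
        ι (E.toFun (EY.linn (EY.rsmul x (ι (E.toFun (star d * u l)) * star (u l))) y * u k)) := by
      intro l
      rw [hM.linn_coe, hM.rsmul_coe, linn_EX_right hEX _ _ (by rw [← hM.rsmul_coe]; exact Subtype.prop _),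
        EY.linn_lsmul_right, star_star, EY.rsmul_mul, EY.linn_rsmul_right]
    simp_rw [this]
    rw [← map_sum, ← E.map_sum, ← Finset.sum_mul, ← EY.sum_linn, ← EY.rsmul_sum, (hu _).2]
  unfold jmap
  simp_rw [F.linn_sum, hup.linn_eq]
  have h2 : ∀ k, ∑ l, ιC (c * ι (M.linn (M.rsmul x (E.toFun (star d * u l)))
      ⟨EX (EY.lsmul (star (u k)) (EY.rsmul y (u l))), hEX.mem _⟩)) * e * ιC (star (u k)) =
      ιC c * e * ιC (ι (E.toFun (EY.linn (EY.rsmul x (star d)) y * u k)) * star (u k)) := by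
    intro k
    rw [← Finset.sum_mul, ← Finset.sum_mul, ← map_sum, ← Finset.mul_sum, h1, map_mul, map_mul,
      mul_assoc (ιC c), hbc.comm]
    simp only [mul_assoc]
  simp_rw [h2]
  rw [← Finset.mul_sum, ← map_sum, (hu _).2]

lemma rinn_jmap_t (hu : IsQuasiBasis E u)
    (hbc : IsBasicConstruction ι E ιC e) (hM : IsRestriction ⇑ι ⇑ι EY X M)
    (hEX : IsBimodCondExp ι ι E E EY X EX) (hup : IsUpwardBasic ι ι E E M ιC e ιC e F t)
    (c : C) (x : X) (d : C) (y : Y) :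
    F.rinn (jmap EY u EX hEX.mem t y) (t c x d) =
      ιC (EY.rinn y (EY.lsmul c x)) * e * ιC (star d) := by
  have h1 : ∀ l, ∑ k, ι (M.rinn
      ⟨EX (EY.lsmul (star (u k)) (EY.rsmul y (u l))), hEX.mem _⟩
      (M.lsmul (E.toFun (star (u k) * c)) x)) =
      ι (E.toFun (star (u l) * EY.rinn y (EY.lsmul c x))) := by
    intro l
    have : ∀ k, ι (M.rinn
      ⟨EX (EY.lsmul (star (u k)) (EY.rsmul y (u l))), hEX.mem _⟩
      (M.lsmul (E.toFun (star (u k) * c)) x)) =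
        ι (E.toFun (star (u l) *
          EY.rinn y (EY.lsmul (u k * ι (E.toFun (star (u k) * c))) x))) := by
      intro k
      rw [hM.rinn_coe, hM.lsmul_coe, ← hEX.cond6 _ _ (by rw [← hM.lsmul_coe]; exact Subtype.prop _),
        EY.rinn_lsmul_left, star_star, EY.mul_lsmul, EY.rinn_rsmul_left]
    simp_rw [this]
    rw [← map_sum, ← E.map_sum, ← Finset.mul_sum, ← EY.rinn_sum, ← EY.sum_lsmul, (hu _).1]
  unfold jmap
  simp_rw [F.sum_rinn, hup.rinn_eq]
  rw [Finset.sum_comm]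
  have h2 : ∀ l, ∑ k, ιC (u l) * e * ιC (ι (M.rinn
      ⟨EX (EY.lsmul (star (u k)) (EY.rsmul y (u l))), hEX.mem _⟩
      (M.lsmul (E.toFun (star (u k) * c)) x)) * star d) =
      ιC (u l * ι (E.toFun (star (u l) * EY.rinn y (EY.lsmul c x)))) * e * ιC (star d) := by
    intro k
    rw [← Finset.mul_sum, ← map_sum, ← Finset.sum_mul, h1, map_mul, map_mul,
      mul_assoc (ιC (u k)), mul_assoc (ιC (u k)), hbc.comm]
    simp only [mul_assoc]
  simp_rw [h2]
  rw [← Finset.sum_mul, ← Finset.sum_mul, ← map_sum, (hu _).1]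

lemma linn_jmap (hu : IsQuasiBasis E u) (hp : IsEquiPair ⇑ι EY X)
    (hbc : IsBasicConstruction ι E ιC e) (hM : IsRestriction ⇑ι ⇑ι EY X M)
    (hEX : IsBimodCondExp ι ι E E EY X EX) (hup : IsUpwardBasic ι ι E E M ιC e ιC e F t)
    (y y' : Y) :
    F.linn (jmap EY u EX hEX.mem t y) (jmap EY u EX hEX.mem t y') = ιC (EY.linn y y') := by
  conv_lhs => arg 2; unfold jmap
  simp_rw [F.sum_linn, linn_t_jmap hu hbc hM hEX hup]
  simp_rw [← Finset.mul_sum, ← map_sum, ← EY.sum_linn, ← EY.lsmul_rsmul]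
  simp_rw [reconstruct_right hu hp hEX, EY.linn_lsmul_left, map_mul, ← mul_assoc]
  rw [← Finset.sum_mul, sum_jones hu hbc, one_mul]

lemma rinn_jmap (hu : IsQuasiBasis E u) (hp : IsEquiPair ⇑ι EY X)
    (hbc : IsBasicConstruction ι E ιC e) (hM : IsRestriction ⇑ι ⇑ι EY X M)
    (hEX : IsBimodCondExp ι ι E E EY X EX) (hup : IsUpwardBasic ι ι E E M ιC e ιC e F t)
    (y y' : Y) :
    F.rinn (jmap EY u EX hEX.mem t y) (jmap EY u EX hEX.mem t y') = ιC (EY.rinn y y') := by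
  conv_lhs => arg 3; unfold jmap
  simp_rw [F.rinn_sum, rinn_jmap_t hu hbc hM hEX hup]
  rw [Finset.sum_comm]
  simp_rw [← Finset.sum_mul, ← map_sum, ← EY.rinn_sum]
  simp_rw [reconstruct_left hu hp hEX, EY.rinn_rsmul_right, map_mul, mul_assoc]
  rw [← Finset.mul_sum]
  simp_rw [← mul_assoc]
  rw [sum_jones hu hbc, mul_one]

lemma e_jmap (hu : IsQuasiBasis E u) (hM : IsRestriction ⇑ι ⇑ι EY X M)
    (hEX : IsBimodCondExp ι ι E E EY X EX) (hup : IsUpwardBasic ι ι E E M ιC e ιC e F t)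
    (y : Y) :
    F.lsmul e (jmap EY u EX hEX.mem t y) =
      ∑ j, t 1 ⟨EX (EY.rsmul y (u j)), hEX.mem _⟩ (u j) := by
  unfold jmap
  simp_rw [F.lsmul_sum, hup.map_eA, hup.bal₁]
  rw [Finset.sum_comm]
  refine Finset.sum_congr rfl fun j _ => ?_
  rw [← hup.sum₂]
  congr 1
  apply Subtype.ext
  rw [AddSubmonoidClass.coe_finsetSum]
  simp_rw [hM.lsmul_coe, ← hEX.cond2, ← EY.mul_lsmul]
  rw [← hEX.map_sum, ← EY.sum_lsmul]
  have := (hu 1).2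
  simp only [one_mul] at this
  rw [this, EY.one_lsmul]

lemma jmap_e (hu : IsQuasiBasis E u) (hM : IsRestriction ⇑ι ⇑ι EY X M)
    (hEX : IsBimodCondExp ι ι E E EY X EX) (hup : IsUpwardBasic ι ι E E M ιC e ιC e F t)
    (y : Y) :
    F.rsmul (jmap EY u EX hEX.mem t y) e =
      ∑ i, t (u i) ⟨EX (EY.lsmul (star (u i)) y), hEX.mem _⟩ 1 := by
  unfold jmap
  simp_rw [F.sum_rsmul, hup.map_eB, hup.bal₂]
  refine Finset.sum_congr rfl fun j _ => ?_
  rw [← hup.sum₂]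
  congr 1
  apply Subtype.ext
  rw [AddSubmonoidClass.coe_finsetSum]
  simp_rw [hM.rsmul_coe, ← hEX.cond5, EY.lsmul_rsmul, ← EY.rsmul_mul]
  rw [← hEX.map_sum, ← EY.lsmul_sum, ← EY.rsmul_sum]
  have := (hu 1).1
  simp only [mul_one, E.map_star] at this
  rw [this, EY.rsmul_one]

lemma e_jmap_e (hu : IsQuasiBasis E u) (hM : IsRestriction ⇑ι ⇑ι EY X M)
    (hEX : IsBimodCondExp ι ι E E EY X EX) (hup : IsUpwardBasic ι ι E E M ιC e ιC e F t)
    (y : Y) :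
    F.lsmul e (F.rsmul (jmap EY u EX hEX.mem t y) e) = t 1 ⟨EX y, hEX.mem _⟩ 1 := by
  rw [jmap_e hu hM hEX hup]
  simp_rw [F.lsmul_sum, hup.map_eA, hup.bal₁]
  rw [← hup.sum₂]
  congr 1
  apply Subtype.ext
  rw [AddSubmonoidClass.coe_finsetSum]
  simp_rw [hM.lsmul_coe, ← hEX.cond2, ← EY.mul_lsmul]
  rw [← hEX.map_sum, ← EY.sum_lsmul]
  have := (hu 1).2
  simp only [one_mul] at this
  rw [this, EY.one_lsmul]

lemma e_jmap_mem (hu : IsQuasiBasis E u) (hM : IsRestriction ⇑ι ⇑ι EY X M)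
    (hEX : IsBimodCondExp ι ι E E EY X EX) (hup : IsUpwardBasic ι ι E E M ιC e ιC e F t)
    (x : X) :
    F.lsmul e (jmap EY u EX hEX.mem t x) = t 1 x 1 := by
  rw [e_jmap hu hM hEX hup]
  have : ∀ j, t 1 ⟨EX (EY.rsmul x (u j)), hEX.mem _⟩ (u j) =
      t 1 x (u j * ι (E.toFun (star (u j)))) := by
    intro j
    rw [E.map_star, ← hup.balanced₂]
    congr 1
    apply Subtype.ext
    rw [hM.rsmul_coe]
    exact hEX.cond4 _ _ x.2
  simp_rw [this]
  rw [← hup.sum₃]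
  have := (hu 1).1
  simp only [mul_one] at this
  rw [this]

lemma jmap_e_mem (hu : IsQuasiBasis E u) (hM : IsRestriction ⇑ι ⇑ι EY X M)
    (hEX : IsBimodCondExp ι ι E E EY X EX) (hup : IsUpwardBasic ι ι E E M ιC e ιC e F t)
    (x : X) :
    F.rsmul (jmap EY u EX hEX.mem t x) e = t 1 x 1 := by
  rw [jmap_e hu hM hEX hup]
  have : ∀ j, t (u j) ⟨EX (EY.lsmul (star (u j)) x), hEX.mem _⟩ 1 =
      t (u j * ι (E.toFun (star (u j)))) x 1 := by
    intro j
    rw [hup.balanced₁]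
    congr 1
    apply Subtype.ext
    rw [hM.lsmul_coe]
    exact hEX.cond1 _ _ x.2
  simp_rw [this]
  rw [← hup.sum₁]
  have := (hu 1).1
  simp only [mul_one] at this
  rw [this]

end JMap

lemma jones_rel
    {A C C₁ C₂ : Type*}
    [CStarAlgebra A] [CStarAlgebra C] [CStarAlgebra C₁] [CStarAlgebra C₂]
    [PartialOrder A] [StarOrderedRing A] [PartialOrder C] [StarOrderedRing C]
    [PartialOrder C₁] [StarOrderedRing C₁] [PartialOrder C₂] [StarOrderedRing C₂]
    (ι : A →⋆ₐ[ℂ] C)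
    (EA : CondExpectation ι) {n : ℕ} (u : Fin n → C) (hu : IsQuasiBasis EA u)
    (r : ℝ) (hr : 0 < r)
    (ιC : C →⋆ₐ[ℂ] C₁) (eA : C₁) (hbc : IsBasicConstruction ι EA ιC eA)
    (EC : CondExpectation ιC)
    (w : Fin n → C₁) (hw : ∀ i, w i = (Real.sqrt r : ℂ) • (ιC (u i) * eA))
    (hwqb : IsQuasiBasis EC w)
    (ιC1 : C₁ →⋆ₐ[ℂ] C₂) (eC : C₂) (hbc2 : IsBasicConstruction ιC EC ιC1 eC) :
    (r : ℂ) • (ιC1 eA * eC * ιC1 eA) = ιC1 eA := by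
  have hsq : (Real.sqrt r : ℂ) * (Real.sqrt r : ℂ) = r := by
    rw [← Complex.ofReal_mul, Real.mul_self_sqrt hr.le]
  have hs := sum_jones hwqb hbc2
  have h1 : ∑ i, EA.toFun (u i) * EA.toFun (star (u i)) = 1 := by
    have := (hu 1).2
    simp only [one_mul] at this
    have h := congrArg EA.toFun this
    rw [EA.map_sum, EA.map_one] at h
    simp_rw [EA.left_mod] at h
    exact h
  have h2 : ∀ i, ιC1 eA * (ιC1 (w i) * eC * ιC1 (star (w i))) * ιC1 eA =
      ιC1 (ιC (ι (EA.toFun (u i) * EA.toFun (star (u i))))) *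
        ((r : ℂ) • (ιC1 eA * eC * ιC1 eA)) := by
    intro i
    have e1 : eA * w i = (Real.sqrt r : ℂ) • (ιC (ι (EA.toFun (u i))) * eA) := by
      rw [hw, mul_smul_comm, ← mul_assoc, hbc.expect]
    have e2 : star (w i) * eA = (Real.sqrt r : ℂ) • (ιC (ι (EA.toFun (star (u i)))) * eA) := by
      rw [hw, star_smul, star_mul, hbc.selfadj, ← map_star, smul_mul_assoc, hbc.expect,
        Complex.star_def, Complex.conj_ofReal]
    calc _ = ιC1 (eA * w i) * eC * ιC1 (star (w i) * eA) := by
          simp only [map_mul, mul_assoc]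
      _ = (r : ℂ) • (ιC1 (ιC (ι (EA.toFun (u i)))) * (ιC1 eA *
            (eC * ιC1 (ιC (ι (EA.toFun (star (u i))))))) * ιC1 eA) := by
          rw [e1, e2, map_smul, map_smul, smul_mul_assoc, smul_mul_assoc, mul_smul_comm, smul_smul,
            hsq]
          simp only [map_mul, mul_assoc]
      _ = _ := by
          rw [← hbc2.comm, ← mul_assoc (ιC1 eA), ← map_mul, ← hbc.comm, mul_smul_comm]
          simp only [map_mul, mul_assoc]
  have h3 : ιC1 eA * (∑ i, ιC1 (w i) * eC * ιC1 (star (w i))) * ιC1 eA = ιC1 eA := by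
    rw [hs, mul_one, ← map_mul, hbc.idem]
  rw [Finset.mul_sum, Finset.sum_mul] at h3
  simp_rw [h2] at h3
  rw [← Finset.sum_mul, ← map_sum, ← map_sum, ← map_sum, h1] at h3
  simpa using h3

/-- the corner embedding `c ↦ ιC c * e`. -/
def cornerHom {A C C₁ : Type*}
    [CStarAlgebra A] [CStarAlgebra C] [CStarAlgebra C₁]
    (ι : A →⋆ₐ[ℂ] C) (ιC : C →⋆ₐ[ℂ] C₁) (e : C₁) (h1 : e * e = e) (h2 : star e = e)
    (h3 : ∀ a, ιC (ι a) * e = e * ιC (ι a)) : A →⋆ₙₐ[ℂ] C₁ where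
  toFun a := ιC (ι a) * e
  map_smul' z a := by simp [smul_mul_assoc]
  map_zero' := by simp
  map_add' a b := by simp [add_mul]
  map_mul' a b := by
    rw [map_mul, map_mul, mul_assoc (ιC (ι a)) e, ← mul_assoc e, ← h3, mul_assoc, mul_assoc,
      h1]
  map_star' a := by rw [star_mul, h2, ← map_star, ← map_star, h3]



/-- Let `A ⊆ C` be a unital inclusion with `A' ∩ C = ℂ1` and `E^A` of
index-finite type, with basic constructions `C₁` and `C₂`.  Let `f`, `f₁` be the
homomorphisms induced by the upward basic construction and `g : Pic(A,C) → Pic(C₁,C₂)`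
the isomorphism induced by the strong Morita equivalence of `A ⊆ C` and `C₁ ⊆ C₂`.
Then `f ∘ g⁻¹ ∘ f₁ = id` on `Pic(C, C₁)`: whenever `g([Xp,Yp]) = f₁([Y,Y₁])`, one has
`f([Xp,Yp]) = [Y,Y₁]`. -/
theorem f_comp_ginv_comp_f_one_eq_id
    {A C C₁ C₂ Yq Tq Ytp Tp VGp : Type*}
    [CStarAlgebra A] [CStarAlgebra C] [CStarAlgebra C₁] [CStarAlgebra C₂]
    [PartialOrder A] [StarOrderedRing A] [PartialOrder C] [StarOrderedRing C]
    [PartialOrder C₁] [StarOrderedRing C₁] [PartialOrder C₂] [StarOrderedRing C₂]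
    [NormedAddCommGroup Yq] [NormedSpace ℂ Yq] [CompleteSpace Yq]
    [NormedAddCommGroup Tq] [NormedSpace ℂ Tq] [CompleteSpace Tq]
    [NormedAddCommGroup Ytp] [NormedSpace ℂ Ytp] [CompleteSpace Ytp]
    [NormedAddCommGroup Tp] [NormedSpace ℂ Tp] [CompleteSpace Tp]
    [NormedAddCommGroup VGp] [NormedSpace ℂ VGp] [CompleteSpace VGp]
    (ι : A →⋆ₐ[ℂ] C) (hι : Function.Injective ι)
    (EA : CondExpectation ι) {n : ℕ} (u : Fin n → C) (hu : IsQuasiBasis EA u)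
    (hirr : IrreducibleIncl ι)
    (r : ℝ) (hr : 0 < r) (hInd : ∑ i, u i * star (u i) = (r : ℂ) • (1 : C))
    (ιC : C →⋆ₐ[ℂ] C₁) (eA : C₁) (hbc : IsBasicConstruction ι EA ιC eA)
    (EC : CondExpectation ιC)
    (hEC : ∀ c d : C, EC.toFun (ιC c * eA * ιC d) = (r⁻¹ : ℂ) • (c * d))
    (w : Fin n → C₁) (hw : ∀ i, w i = (Real.sqrt r : ℂ) • (ιC (u i) * eA))
    (hwqb : IsQuasiBasis EC w)
    (ιC1 : C₁ →⋆ₐ[ℂ] C₂) (eC : C₂) (hbc2 : IsBasicConstruction ιC EC ιC1 eC)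
    -- an element `(Y, Y₁) ∈ Equi(C, C₁)`
    (EYq : EquivBimodule C₁ C₁ Yq) (Xq : Submodule ℂ Yq)
    (hqpair : IsEquiPair ⇑ιC EYq Xq)
    [CompleteSpace Xq] (Mq : EquivBimodule C C Xq)
    (hMq : IsRestriction ⇑ιC ⇑ιC EYq Xq Mq)
    (EXq : Yq → Yq) (hEXq : IsBimodCondExp ιC ιC EC EC EYq Xq EXq)
    -- `f₁([Y, Y₁]) = [Y₁, Y₂]`
    (Fq₁ : EquivBimodule C₂ C₂ Tq) (tq : C₁ → Xq → C₁ → Tq)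
    (hupq : IsUpwardBasic ιC ιC EC EC Mq ιC1 eC ιC1 eC Fq₁ tq)
    -- an element `(Xp, Yp) ∈ Equi(A, C)` (a representative of `g⁻¹(f₁([Y, Y₁]))`)
    (EYp : EquivBimodule C C Ytp) (Xp : Submodule ℂ Ytp)
    (hppair : IsEquiPair ⇑ι EYp Xp)
    [CompleteSpace Xp] (MXp : EquivBimodule A A Xp)
    (hMXp : IsRestriction ⇑ι ⇑ι EYp Xp MXp)
    (EXp : Ytp → Ytp) (hEXp : IsBimodCondExp ι ι EA EA EYp Xp EXp)
    -- `f([Xp, Yp]) = [Yp, (Yp)₁]`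
    (Fp : EquivBimodule C₁ C₁ Tp) (tp : C → Xp → C → Tp)
    (hupp : IsUpwardBasic ι ι EA EA MXp ιC eA ιC eA Fp tp)
    -- `g([Xp, Yp]) = [C ⊗_A Xp ⊗_A C̃, C₁ ⊗_C Yp ⊗_C C̃₁]`
    (Gp : EquivBimodule C₂ C₂ VGp) (rgp : C₁ → Ytp → C₁ → VGp)
    (hgp : IsUpwardBasic ιC ιC EC EC EYp ιC1 eC ιC1 eC Gp rgp)
    -- the hypothesis `g([Xp, Yp]) = f₁([Y, Y₁])` in `Pic(C₁, C₂)`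
    (hginv : PairEquiv Gp
      ((Submodule.span ℂ {v : VGp | ∃ c d : C, ∃ x ∈ Xp,
        v = (r : ℂ) • rgp (ιC c * eA) x (ιC d * eA)}).topologicalClosure)
      Fq₁
      ((Submodule.span ℂ (Set.range fun y : Yq => ∑ i, ∑ j, tq (w i)
        ⟨EXq (EYq.lsmul (star (w i)) (EYq.rsmul y (w j))), hEXq.mem _⟩
        (w j))).topologicalClosure)) :
    -- conclusion: `f([Xp, Yp]) = [Y, Y₁]` in `Pic(C, C₁)`
    PairEquiv Fp
      ((Submodule.span ℂ (Set.range fun y : Ytp => ∑ i, ∑ j, tp (u i)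
        ⟨EXp (EYp.lsmul (star (u i)) (EYp.rsmul y (u j))), hEXp.mem _⟩
        (u j))).topologicalClosure)
      EYq Xq := by
  have hrc : (r : ℂ) ≠ 0 := by exact_mod_cast hr.ne'
  have hjr := jones_rel ι EA u hu r hr ιC eA hbc EC w hw hwqb ιC1 eC hbc2
  have hEC1 : ∀ c, EC.toFun (ιC c * eA) = (r⁻¹ : ℂ) • c := by
    intro c
    have := hEC c 1
    rwa [map_one, mul_one, mul_one] at this
  have hECc : ∀ c d, EC.toFun (star (ιC c * eA) * (ιC d * eA)) =
      (r⁻¹ : ℂ) • ι (EA.toFun (star c * d)) := by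
    intro c d
    rw [star_mul, hbc.selfadj, ← map_star, ← hEC1, ← hbc.expect, map_mul]
    simp only [mul_assoc]
  -- the map J
  obtain ⟨J, hJ, hJl, hJr, hJrange⟩ := exists_extension EYq Fq₁
    (ιC1 : C₁ →⋆ₙₐ[ℂ] C₂) (ιC1 : C₁ →⋆ₙₐ[ℂ] C₂) hbc2.inj hbc2.inj (fun y : Yq => y)
    (jmap EYq w EXq hEXq.mem tq)
    (by
      have : (Set.range fun y : Yq => y) = Set.univ := Set.range_id
      rw [this, Submodule.span_univ]; exact dense_univ)
    (linn_jmap hwqb hqpair hbc2 hMq hEXq hupq) (rinn_jmap hwqb hqpair hbc2 hMq hEXq hupq)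
  -- the map K
  have hdense : Dense (Submodule.span ℂ
      (Set.range fun p : C × Xp × C => tp p.1 p.2.1 p.2.2) : Set Tp) := by
    have h := hupp.dense
    convert h using 4
    ext v
    constructor
    · rintro ⟨⟨c, x, d⟩, rfl⟩; exact ⟨c, x, d, rfl⟩
    · rintro ⟨c, x, d, rfl⟩; exact ⟨⟨c, x, d⟩, rfl⟩
  have hkl : ∀ c d c' d' (x x' : Xp), Gp.linn ((r : ℂ) • rgp (ιC c * eA) x (ιC d * eA))
      ((r : ℂ) • rgp (ιC c' * eA) x' (ιC d' * eA)) = ιC1 (Fp.linn (tp c x d) (tp c' x' d')) := by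
    intro c d c' d' x x'
    rw [Gp.linn_smul_left, Gp.linn_smul_right, hgp.linn_eq, hupp.linn_eq, hECc, EYp.smul_rsmul,
      EYp.linn_smul_left, ← hMXp.rsmul_coe, ← hMXp.linn_coe, Complex.star_def,
      Complex.conj_ofReal]
    set m := MXp.linn (MXp.rsmul x (EA.toFun (star d * d'))) x'
    rw [map_smul, mul_smul_comm, map_smul, smul_mul_assoc, smul_mul_assoc, smul_smul, smul_smul,
      mul_assoc (ιC c), ← hbc.comm, star_mul, hbc.selfadj, ← map_star]
    have : (r : ℂ) * (r : ℂ) * (r : ℂ)⁻¹ = r := by field_simp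
    rw [this]
    calc _ = ιC1 (ιC c * ιC (ι m)) * ((r : ℂ) • (ιC1 eA * eC * ιC1 eA)) * ιC1 (ιC (star c')) := by
          rw [mul_smul_comm, smul_mul_assoc]; simp only [map_mul, mul_assoc]
      _ = _ := by rw [hjr]; simp only [map_mul]
  have hkr : ∀ c d c' d' (x x' : Xp), Gp.rinn ((r : ℂ) • rgp (ιC c * eA) x (ιC d * eA))
      ((r : ℂ) • rgp (ιC c' * eA) x' (ιC d' * eA)) = ιC1 (Fp.rinn (tp c x d) (tp c' x' d')) := by
    intro c d c' d' x x'
    rw [Gp.rinn_smul_left, Gp.rinn_smul_right, hgp.rinn_eq, hupp.rinn_eq, hECc, EYp.smul_lsmul,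
      EYp.rinn_smul_right, ← hMXp.lsmul_coe, ← hMXp.rinn_coe, Complex.star_def,
      Complex.conj_ofReal]
    set m := MXp.rinn x (MXp.lsmul (EA.toFun (star c * c')) x')
    rw [map_smul, smul_mul_assoc, map_smul, mul_smul_comm, smul_smul, smul_smul,
      star_mul, hbc.selfadj, ← map_star, ← mul_assoc (ιC (ι m)), hbc.comm]
    have : (r : ℂ) * (r : ℂ) * (r : ℂ)⁻¹ = r := by field_simp
    rw [this]
    calc _ = ιC1 (ιC d) * ((r : ℂ) • (ιC1 eA * eC * ιC1 eA)) *
            ιC1 (ιC (ι m) * ιC (star d')) := by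
          rw [mul_smul_comm, smul_mul_assoc]; simp only [map_mul, mul_assoc]
      _ = _ := by rw [hjr]; simp only [map_mul, mul_assoc]
  obtain ⟨K, hK, hKl, hKr, hKrange⟩ := exists_extension Fp Gp
    (ιC1 : C₁ →⋆ₙₐ[ℂ] C₂) (ιC1 : C₁ →⋆ₙₐ[ℂ] C₂) hbc2.inj hbc2.inj
    (fun p : C × Xp × C => tp p.1 p.2.1 p.2.2)
    (fun p : C × Xp × C => (r : ℂ) • rgp (ιC p.1 * eA) p.2.1 (ιC p.2.2 * eA))
    hdense (fun i j => hkl _ _ _ _ _ _) (fun i j => hkr _ _ _ _ _ _)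
  -- the corner map ρ
  obtain ⟨ρ, hρ, -, -, -⟩ := exists_extension EYp Gp
    (cornerHom ιC ιC1 eC hbc2.idem hbc2.selfadj hbc2.comm)
    (cornerHom ιC ιC1 eC hbc2.idem hbc2.selfadj hbc2.comm)
    (by
      rw [injective_iff_map_eq_zero]
      intro c hc
      exact hbc.inj ((hbc2.faithful _ hc).trans (map_zero ιC).symm))
    (by
      rw [injective_iff_map_eq_zero]
      intro c hc
      exact hbc.inj ((hbc2.faithful _ hc).trans (map_zero ιC).symm))
    (fun y : Ytp => y) (fun y => rgp 1 y 1)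
    (by
      have : (Set.range fun y : Ytp => y) = Set.univ := Set.range_id
      rw [this, Submodule.span_univ]; exact dense_univ)
    (by
      intro y y'
      rw [hgp.linn_eq, star_one, mul_one, EC.map_one, EYp.rsmul_one, map_one, mul_one,
        one_mul]
      rfl)
    (by
      intro y y'
      rw [hgp.rinn_eq, star_one, mul_one, mul_one, EC.map_one, EYp.one_lsmul, map_one,
        one_mul]
      exact (hbc2.comm _).symm)
  -- the key facts about `K (i_p y)`
  set ip : Ytp → Tp := jmap EYp u EXp hEXp.mem tp with hip
  have hKip : ∀ y, K (ip y) = ∑ i, ∑ j, (r : ℂ) • rgp (ιC (u i) * eA)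
      (EXp (EYp.lsmul (star (u i)) (EYp.rsmul y (u j)))) (ιC (u j) * eA) := by
    intro y
    rw [hip]
    unfold jmap
    simp_rw [map_sum]
    refine Finset.sum_congr rfl fun i _ => Finset.sum_congr rfl fun j _ => ?_
    exact hK (u i, ⟨_, hEXp.mem _⟩, u j)
  have hone := sum_jones hu hbc
  have hL : ∀ y, Gp.lsmul eC (K (ip y)) = rgp 1 y 1 := by
    intro y
    rw [hKip]
    simp_rw [Gp.lsmul_sum, Gp.lsmul_smul, hgp.map_eA, hEC1, map_smul, hgp.smul₁, smul_smul,
      mul_inv_cancel₀ hrc, one_smul, hgp.bal₁]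
    rw [Finset.sum_comm]
    simp_rw [← hgp.sum₂, reconstruct_left hu hppair hEXp, hgp.balanced₂]
    rw [← hgp.sum₃, hone]
  have hR : ∀ y, Gp.rsmul (K (ip y)) eC = rgp 1 y 1 := by
    intro y
    rw [hKip]
    simp_rw [Gp.sum_rsmul, Gp.rsmul_smul, hgp.map_eB, hEC1, map_smul, hgp.smul₃, smul_smul]
    have hc : (r : ℂ) * (starRingEnd ℂ) ((r : ℂ)⁻¹) = 1 := by
      rw [map_inv₀, Complex.conj_ofReal, mul_inv_cancel₀ hrc]
    simp_rw [hc, one_smul, hgp.bal₂, ← hgp.sum₂, ← EYp.lsmul_rsmul]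
    simp_rw [reconstruct_right hu hppair hEXp, ← hgp.balanced₁]
    rw [← hgp.sum₁, hone]
  -- the isomorphism
  obtain ⟨Φ, hΦ⟩ := hginv
  have hrange : (LinearMap.range K.toLinearMap).map Φ.toEquiv.toLinearMap =
      LinearMap.range J.toLinearMap := by
    rw [hKrange, hJrange]
    refine Eq.trans ?_ hΦ
    congr 3
    ext v
    constructor
    · rintro ⟨⟨c, x, d⟩, rfl⟩; exact ⟨c, d, x, x.2, rfl⟩
    · rintro ⟨c, d, x, hx, rfl⟩; exact ⟨⟨c, ⟨x, hx⟩, d⟩, rfl⟩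
  let Ψ : Tp ≃ₗ[ℂ] Yq :=
    ((LinearEquiv.ofInjective K.toLinearMap K.injective).trans
      ((Φ.toEquiv.submoduleMap _).trans (LinearEquiv.ofEq _ _ hrange))).trans
      (LinearEquiv.ofInjective J.toLinearMap J.injective).symm
  have hΨ : ∀ v, J (Ψ v) = Φ.toEquiv (K v) := by
    intro v
    have : LinearEquiv.ofInjective J.toLinearMap J.injective (Ψ v) =
      (LinearEquiv.ofEq _ _ hrange) ((Φ.toEquiv.submoduleMap _)
        (LinearEquiv.ofInjective K.toLinearMap K.injective v)) :=
      LinearEquiv.apply_symm_apply _ _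
    exact congrArg Subtype.val this
  have hΨl : ∀ v v', EYq.linn (Ψ v) (Ψ v') = Fp.linn v v' := by
    intro v v'
    apply hbc2.inj
    have h1 := hJl (Ψ v) (Ψ v')
    rw [hΨ, hΨ, Φ.map_linn, hKl] at h1
    exact h1.symm
  have hΨr : ∀ v v', EYq.rinn (Ψ v) (Ψ v') = Fp.rinn v v' := by
    intro v v'
    apply hbc2.inj
    have h1 := hJr (Ψ v) (Ψ v')
    rw [hΨ, hΨ, Φ.map_rinn, hKr] at h1
    exact h1.symm
  have hΨn : ∀ v, ‖Ψ v‖ = ‖v‖ := by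
    intro v
    have := EYq.norm_linn (Ψ v)
    rw [hΨl, Fp.norm_linn] at this
    exact ((sq_eq_sq₀ (norm_nonneg _) (norm_nonneg _)).mp this).symm
  have hΨc : Continuous Ψ :=
    (LinearIsometry.mk Ψ.toLinearMap hΨn).continuous
  refine ⟨⟨Ψ, ?_, ?_, hΨl, hΨr⟩, ?_⟩
  · intro c v
    apply EYq.ext_linn
    intro z
    obtain ⟨z, rfl⟩ := Ψ.surjective z
    rw [hΨl, EYq.linn_lsmul_left, hΨl, Fp.linn_lsmul_left]
  · intro v c
    apply EYq.ext_rinn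
    intro z
    obtain ⟨z, rfl⟩ := Ψ.surjective z
    rw [hΨr, EYq.rinn_rsmul_right, hΨr, Fp.rinn_rsmul_right]
  -- the subspaces
  have cancelJ : ∀ y y', Fq₁.lsmul eC (J y) = Fq₁.lsmul eC (J y') → y = y' := by
    intro y y' h
    apply EYq.ext_linn
    intro z
    rw [← sub_eq_zero]
    apply faithful_left hbc2
    have h1 := congrArg (fun v => Fq₁.linn v (J z)) h
    simp only [Fq₁.linn_lsmul_left, hJl] at h1
    rw [map_sub, mul_sub]
    exact sub_eq_zero.mpr h1
  have cancelK : ∀ y y', Gp.lsmul eC (K y) = Gp.lsmul eC (K y') → y = y' := by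
    intro y y' h
    apply Fp.ext_linn
    intro z
    rw [← sub_eq_zero]
    apply faithful_left hbc2
    have h1 := congrArg (fun v => Gp.linn v (K z)) h
    simp only [Gp.linn_lsmul_left, hKl] at h1
    rw [map_sub, mul_sub]
    exact sub_eq_zero.mpr h1
  have hJidem : ∀ v : Tq, Fq₁.lsmul eC (Fq₁.lsmul eC v) = Fq₁.lsmul eC v := by
    intro v; rw [← Fq₁.mul_lsmul, hbc2.idem]
  have hGidem : ∀ v : VGp, Gp.lsmul eC (Gp.lsmul eC v) = Gp.lsmul eC v := by
    intro v; rw [← Gp.mul_lsmul, hbc2.idem]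
  have hmem : ∀ y, Ψ (ip y) ∈ Xq := by
    intro y
    have hcomm : Fq₁.lsmul eC (J (Ψ (ip y))) = Fq₁.rsmul (J (Ψ (ip y))) eC := by
      rw [hΨ, ← Φ.map_lsmul, ← Φ.map_rsmul, hL, hR]
    have h1 : Fq₁.lsmul eC (J (Ψ (ip y))) = Fq₁.lsmul eC (J (EXq (Ψ (ip y)))) := by
      rw [← hJidem, hcomm, hJ, hJ]
      have a1 := e_jmap_e hwqb hMq hEXq hupq (Ψ (ip y))
      have a2 := e_jmap_mem hwqb hMq hEXq hupq ⟨EXq (Ψ (ip y)), hEXq.mem _⟩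
      rw [a1, a2]
    rw [cancelJ _ _ h1]
    exact hEXq.mem _
  have hcorner : ∀ v : VGp, ∃ y, Gp.lsmul eC (Gp.rsmul v eC) = rgp 1 y 1 := by
    intro v
    have hcl : IsClosed {v : VGp | Gp.lsmul eC (Gp.rsmul v eC) ∈ Set.range ρ} :=
      ρ.isometry.isClosedEmbedding.isClosed_range.preimage
        ((Gp.continuous_lsmul eC).comp (Gp.continuous_rsmul eC))
    have hsub : (Submodule.span ℂ {v : VGp | ∃ c x d, v = rgp c x d} : Set VGp) ⊆
        {v : VGp | Gp.lsmul eC (Gp.rsmul v eC) ∈ Set.range ρ} := by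
      have : Submodule.span ℂ {v : VGp | ∃ c x d, v = rgp c x d} ≤
          (LinearMap.range ρ.toLinearMap).comap ((Gp.lsmulL eC).comp (Gp.rsmulL eC)) := by
        rw [Submodule.span_le]
        rintro _ ⟨c, x, d, rfl⟩
        refine ⟨EYp.lsmul (EC.toFun c) (EYp.rsmul x (star (EC.toFun d))), ?_⟩
        show ρ _ = Gp.lsmul eC (Gp.rsmul (rgp c x d) eC)
        rw [hgp.map_eB, hgp.map_eA, hgp.bal₁, hgp.bal₂, hρ, EYp.lsmul_rsmul]
      exact this
    have h1 := (hgp.dense.mono hsub).closure_eq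
    rw [hcl.closure_eq] at h1
    obtain ⟨y, hy⟩ : v ∈ {v : VGp | Gp.lsmul eC (Gp.rsmul v eC) ∈ Set.range ρ} := by
      rw [h1]; trivial
    exact ⟨y, by rw [← hy, hρ]⟩
  have hsurj : ∀ x ∈ Xq, ∃ y, Ψ (ip y) = x := by
    intro x hx
    obtain ⟨v, rfl⟩ := Ψ.surjective x
    have a1 := e_jmap_mem hwqb hMq hEXq hupq ⟨_, hx⟩
    have a2 := jmap_e_mem hwqb hMq hEXq hupq ⟨_, hx⟩
    have hcomm : Gp.lsmul eC (K v) = Gp.rsmul (K v) eC := by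
      apply Φ.toEquiv.injective
      rw [Φ.map_lsmul, Φ.map_rsmul, ← hΨ, hJ]
      exact a1.trans a2.symm
    obtain ⟨y, hy⟩ := hcorner (K v)
    refine ⟨y, ?_⟩
    congr 1
    apply cancelK
    rw [hL, ← hy, ← hcomm, hGidem]
  apply le_antisymm
  · rw [Submodule.map_le_iff_le_comap]
    apply Submodule.topologicalClosure_minimal
    · rw [Submodule.span_le]
      rintro _ ⟨y, rfl⟩
      exact hmem y
    · exact hqpair.closed.preimage hΨc
  · intro x hx
    obtain ⟨y, rfl⟩ := hsurj x hx
    exact ⟨ip y, Submodule.le_topologicalClosure _ (Submodule.subset_span ⟨y, rfl⟩), rfl⟩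

end
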